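/- arXiv:0910.1409 — 5 statements merged into one kernel-verified Lean document; each statement's English description precedes it below -/
import Mathlib

section
/- For every integer k ≥ 1, every shortest-path metric supported on a graph of pathwidth at most k admits a stochastic D-embedding into the family of shortest-path metrics supported on trees, where D ≤ (k+1) · (4k)^{k·(binom(k+1,2)+1)}; in particular D ≤ O(k)^{O(k^3)}. -/
open scoped BigOperators

/-- A path decomposition of `G` with `t` bags. -/
def IsPathDecomp {V : Type*} (G : SimpleGraph V) (t : ℕ) (X : Fin t → Finset V) : Prop :=
  (∀ v : V, ∃ i, v ∈ X i) ∧
  (∀ ⦃u v : V⦄, G.Adj u v → ∃ i, u ∈ X i ∧ v ∈ X i) ∧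
  (∀ (v : V) (i j l : Fin t), i ≤ j → j ≤ l → v ∈ X i → v ∈ X l → v ∈ X j)

/-- The pathwidth of `G` is at most `k`. -/
def pathwidthLE {V : Type*} (G : SimpleGraph V) (k : ℕ) : Prop :=
  ∃ (t : ℕ) (X : Fin t → Finset V), IsPathDecomp G t X ∧ ∀ i, (X i).card ≤ k + 1

/-- The pathwidth of `G`. -/
noncomputable def pathwidth {V : Type*} (G : SimpleGraph V) : ℕ :=
  sInf {k | pathwidthLE G k}
/-- Shortest-path (pseudo)metric of the metric graph `(G, len)`. -/
noncomputable def spDist {V : Type*} (G : SimpleGraph V) (len : Sym2 V → ℝ) (u v : V) : ℝ :=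
  sInf (Set.range fun w : G.Walk u v => (w.edges.map len).sum)
/-- A finite "metric space": a size `n` together with a distance function on `Fin n`. -/
def FinMetric : Type := (n : ℕ) × (Fin n → Fin n → ℝ)

/-- A family of finite graphs (one set of graphs for each vertex count). -/
def GraphFamily : Type := ∀ n : ℕ, Set (SimpleGraph (Fin n))

/-- The shortest-path metrics supported on (connected) metric graphs from the family `F`. -/
def SupportedMetrics (F : GraphFamily) : Set FinMetric :=
  { Y | ∃ G ∈ F Y.1, G.Connected ∧ ∃ len : Sym2 (Fin Y.1) → ℝ,
      (∀ e, 0 ≤ len e) ∧ ∀ u v, Y.2 u v = spDist G len u v }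
/-- `(X, d)` admits a stochastic `D`-embedding into the family `𝒴`: there is a finitely
supported random metric space `Y ∈ 𝒴` and a random map `F` into it which is almost surely
non-contracting, and whose expected expansion is at most `D` on every pair. -/
def StochEmbeds {X : Type*} [Fintype X] (d : X → X → ℝ) (𝒴 : Set FinMetric) (D : ℝ) : Prop :=
  ∃ (N : ℕ) (p : Fin N → ℝ) (Y : Fin N → FinMetric) (F : (ω : Fin N) → X → Fin (Y ω).1),
    (∀ ω, 0 ≤ p ω) ∧ (∑ ω, p ω = 1) ∧
    (∀ ω, p ω ≠ 0 → Y ω ∈ 𝒴) ∧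
    (∀ ω, p ω ≠ 0 → ∀ x y, d x y ≤ (Y ω).2 (F ω x) (F ω y)) ∧
    (∀ x y, (∑ ω, p ω * (Y ω).2 (F ω x) (F ω y)) ≤ D * d x y)
/-- All graphs of pathwidth at most `k`. -/
def PathwidthFam (k : ℕ) : GraphFamily := fun _ => {G | pathwidthLE G k}

/-- All trees (connected acyclic graphs). -/
def TreeFam : GraphFamily := fun _ => {G | G.IsTree}

/-- All trees of pathwidth at most `k`. -/
def TreePathwidthFam (k : ℕ) : GraphFamily := fun _ => {G | G.IsTree ∧ pathwidthLE G k}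


section ShortestPath

variable {V : Type*} {G : SimpleGraph V} {len : Sym2 V → ℝ}

lemma walk_length_nonneg (hlen : ∀ e, 0 ≤ len e) {u v : V} (p : G.Walk u v) :
    0 ≤ (p.edges.map len).sum :=
  List.sum_nonneg fun x hx => by
    obtain ⟨e, -, rfl⟩ := List.mem_map.1 hx
    exact hlen e

lemma spDist_nonneg (hlen : ∀ e, 0 ≤ len e) (u v : V) : 0 ≤ spDist G len u v :=
  Real.sInf_nonneg (by rintro _ ⟨p, rfl⟩; exact walk_length_nonneg hlen p)

lemma spDist_le_walk (hlen : ∀ e, 0 ≤ len e) {u v : V} (p : G.Walk u v) :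
    spDist G len u v ≤ (p.edges.map len).sum :=
  csInf_le ⟨0, by rintro _ ⟨q, rfl⟩; exact walk_length_nonneg hlen q⟩ ⟨p, rfl⟩

lemma spDist_self (hlen : ∀ e, 0 ≤ len e) (u : V) : spDist G len u u = 0 :=
  le_antisymm (by simpa using spDist_le_walk hlen (SimpleGraph.Walk.nil : G.Walk u u))
    (spDist_nonneg hlen u u)

lemma spDist_le_of_adj (hlen : ∀ e, 0 ≤ len e) {u v : V} (h : G.Adj u v) :
    spDist G len u v ≤ len s(u, v) := by
  simpa using spDist_le_walk hlen h.toWalk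

lemma spDist_comm (u v : V) : spDist G len u v = spDist G len v u := by
  unfold spDist
  congr 1
  ext x
  constructor
  · rintro ⟨p, rfl⟩
    exact ⟨p.reverse, by simp⟩
  · rintro ⟨p, rfl⟩
    exact ⟨p.reverse, by simp⟩

lemma walk_length_bypass_le [DecidableEq V] (hlen : ∀ e, 0 ≤ len e) {u v : V}
    (p : G.Walk u v) : (p.bypass.edges.map len).sum ≤ (p.edges.map len).sum := by
  rw [← List.sum_toFinset _ p.bypass_isPath.isTrail.edges_nodup]
  calc ∑ e ∈ p.bypass.edges.toFinset, len e ≤ ∑ e ∈ p.edges.toFinset, len e :=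
        Finset.sum_le_sum_of_subset_of_nonneg
          (fun e he => by
            rw [List.mem_toFinset] at he ⊢
            exact p.edges_bypass_subset_edges he)
          (fun e _ _ => hlen e)
    _ = (p.edges.dedup.map len).sum := by
        rw [← List.sum_toFinset _ p.edges.nodup_dedup]; congr 1; ext; simp
    _ ≤ (p.edges.map len).sum :=
        ((List.dedup_sublist _).map len).sum_le_sum fun x hx => by
          obtain ⟨e, -, rfl⟩ := List.mem_map.1 hx
          exact hlen e

lemma exists_path_eq_spDist [Finite V] (hlen : ∀ e, 0 ≤ len e) {u v : V}
    (h : G.Reachable u v) :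
    ∃ p : G.Walk u v, p.IsPath ∧ (p.edges.map len).sum = spDist G len u v := by
  classical
  have := Fintype.ofFinite V
  obtain ⟨p₀⟩ := h
  have : Nonempty (G.Path u v) := ⟨p₀.toPath⟩
  obtain ⟨p, hp⟩ := Finite.exists_min fun p : G.Path u v => (p.1.edges.map len).sum
  refine ⟨p.1, p.2, le_antisymm ?_ (spDist_le_walk hlen _)⟩
  refine le_csInf ⟨_, p₀, rfl⟩ ?_
  rintro _ ⟨q, rfl⟩
  exact (hp q.toPath).trans (walk_length_bypass_le hlen q)

lemma spDist_triangle [Finite V] (hlen : ∀ e, 0 ≤ len e) {u v w : V}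
    (huv : G.Reachable u v) (hvw : G.Reachable v w) :
    spDist G len u w ≤ spDist G len u v + spDist G len v w := by
  obtain ⟨p, -, hp⟩ := exists_path_eq_spDist hlen huv
  obtain ⟨q, -, hq⟩ := exists_path_eq_spDist hlen hvw
  rw [← hp, ← hq]
  simpa using spDist_le_walk hlen (p.append q)

lemma spDist_mono [Finite V] (hlen : ∀ e, 0 ≤ len e) {G' : SimpleGraph V} (hle : G' ≤ G)
    {u v : V} (h : G'.Reachable u v) : spDist G len u v ≤ spDist G' len u v := by
  obtain ⟨p, -, hp⟩ := exists_path_eq_spDist hlen h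
  rw [← hp]
  simpa using spDist_le_walk hlen (p.mapLe hle)

end ShortestPath

/-- `ParentChain par x y L`: the sequence `L` of parent edges `v — par v`, each traversed upwards or
downwards, leads from `x` to `y`. -/
inductive ParentChain {V : Type*} (par : V → V) : V → V → List V → Prop
  | nil (x : V) : ParentChain par x x []
  | up {x y : V} {L : List V} :
      par x ≠ x → ParentChain par (par x) y L → ParentChain par x y (x :: L)
  | down {x y : V} {L : List V} :
      par x ≠ x → ParentChain par x y L → ParentChain par (par x) y (x :: L)

namespace ParentChain

variable {V : Type*} {par par' : V → V} {x y z : V} {L L' : List V}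

lemma append (h : ParentChain par x y L) (h' : ParentChain par y z L') :
    ParentChain par x z (L ++ L') := by
  induction h with
  | nil => exact h'
  | up hx _ ih => exact .up hx (ih h')
  | down hx _ ih => exact .down hx (ih h')

lemma reverse (h : ParentChain par x y L) : ParentChain par y x L.reverse := by
  induction h with
  | nil => exact .nil _
  | up hx _ ih => simpa using ih.append (.down hx (.nil _))
  | down hx _ ih => simpa using ih.append (.up hx (.nil _))

lemma congr (h : ParentChain par x y L) (hL : ∀ v ∈ L, par' v = par v) :
    ParentChain par' x y L := by
  induction h with
  | nil => exact .nil _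
  | @up x y L hx _ ih =>
    have hx' := hL x (by simp)
    refine .up (by rwa [hx']) ?_
    rw [hx']
    exact ih fun v hv => hL v (by simp [hv])
  | @down x y L hx _ ih =>
    have hx' := hL x (by simp)
    rw [← hx']
    exact .down (by rwa [hx']) (ih fun v hv => hL v (by simp [hv]))

lemma par_ne (h : ParentChain par x y L) : ∀ v ∈ L, par v ≠ v := by
  induction h with
  | nil => simp
  | up hx _ ih => simpa using ⟨hx, ih⟩
  | down hx _ ih => simpa using ⟨hx, ih⟩

lemma lipschitz_bound (h : ParentChain par x y L) {f e : V → ℝ} (he : ∀ v, 0 ≤ e v)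
    (hf : ∀ v, |f v - f (par v)| ≤ e v) :
    ∀ v ∈ L, f x - (L.map e).sum ≤ f v ∧ f x - (L.map e).sum ≤ f (par v) := by
  induction h with
  | nil => simp
  | @up x y L hx _ ih =>
    have hs : 0 ≤ (L.map e).sum := List.sum_nonneg (by simpa using fun a _ => he a)
    have := abs_le.1 (hf x)
    have := he x
    intro v hv
    rw [List.map_cons, List.sum_cons]
    rcases List.mem_cons.1 hv with rfl | hv
    · constructor <;> linarith
    · have := ih v hv
      constructor <;> linarith
  | @down x y L hx _ ih =>
    have hs : 0 ≤ (L.map e).sum := List.sum_nonneg (by simpa using fun a _ => he a)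
    have := abs_le.1 (hf x)
    have := he x
    intro v hv
    rw [List.map_cons, List.sum_cons]
    rcases List.mem_cons.1 hv with rfl | hv
    · constructor <;> linarith
    · have := ih v hv
      constructor <;> linarith

end ParentChain

/-- Parent pointers without nontrivial cycles, staying inside the components of `H`. -/
structure IsParentForest {V : Type*} (H : SimpleGraph V) (par : V → V) : Prop where
  reachable : ∀ v, H.Reachable v (par v)
  ranked : ∃ rk : V → ℕ, ∀ v, par v ≠ v → rk (par v) < rk v

/-- A uniformly random parent forest that stretches the edges of `H` by at most `D` on average. -/
def HasRandomForest {V : Type*} (H : SimpleGraph V) (len : Sym2 V → ℝ) (D : ℝ) : Prop :=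
  ∃ (Ω : Type) (_ : Fintype Ω) (_ : Nonempty Ω) (par : Ω → V → V),
    (∀ ω, IsParentForest H (par ω)) ∧
    ∀ x y, H.Adj x y → ∃ L : Ω → List V, (∀ ω, ParentChain (par ω) x y (L ω)) ∧
      ∑ ω, ((L ω).map fun v => spDist H len v (par ω v)).sum ≤
        Fintype.card Ω * (D * len s(x, y))

section Spine

variable {V : Type*} {H : SimpleGraph V} {len : Sym2 V → ℝ}

lemma exists_parent_of_geodesic [Finite V] (hlen : ∀ e, 0 ≤ len e) {s t : V}
    (P : H.Walk s t) (hP : P.IsPath) (hPd : (P.edges.map len).sum = spDist H len s t) :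
    ∃ (q : V → V) (r : V → ℕ),
      (∀ v ∈ P.support, q v ∈ P.support ∧ (q v ≠ v → r (q v) < r v)) ∧
      ∀ a ∈ P.support, ∀ b ∈ P.support, ∃ L, ParentChain q a b L ∧ (∀ v ∈ L, v ∈ P.support) ∧
        (L.map fun v => spDist H len v (q v)).sum ≤ spDist H len a b := by
  classical
  induction P with
  | @nil u =>
    refine ⟨id, fun _ => 0, by simp, ?_⟩
    intro a ha b hb
    simp only [SimpleGraph.Walk.support_nil, List.mem_singleton] at ha hb
    subst ha hb
    exact ⟨[], .nil _, by simp, by simpa using spDist_nonneg hlen _ _⟩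
  | @cons s s' t hadj P ih =>
    rw [SimpleGraph.Walk.cons_isPath_iff] at hP
    obtain ⟨hP, hs⟩ := hP
    simp only [SimpleGraph.Walk.edges_cons, List.map_cons, List.sum_cons] at hPd
    have hs's : spDist H len s s' ≤ len s(s, s') := spDist_le_of_adj hlen hadj
    have hP' : (P.edges.map len).sum = spDist H len s' t := by
      refine le_antisymm ?_ (spDist_le_walk hlen P)
      have := spDist_triangle hlen hadj.reachable ⟨P⟩
      linarith
    obtain ⟨q, r, hq, hL⟩ := ih hP hP'
    have key : ∀ b ∈ P.support, spDist H len s s' + spDist H len s' b ≤ spDist H len s b := by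
      intro b hb
      have h1 := spDist_le_walk hlen (P.takeUntil b hb)
      have h2 := spDist_le_walk hlen (P.dropUntil b hb)
      have h3 : (P.edges.map len).sum = ((P.takeUntil b hb).edges.map len).sum +
          ((P.dropUntil b hb).edges.map len).sum := by
        rw [← List.sum_append, ← List.map_append, ← SimpleGraph.Walk.edges_append, P.take_spec hb]
      have h4 := spDist_triangle hlen (hadj.reachable.trans ⟨P.takeUntil b hb⟩)
        ⟨P.dropUntil b hb⟩
      linarith
    have hne : ∀ v ∈ P.support, v ≠ s := fun v hv h => hs (h ▸ hv)
    have hagree : ∀ v ∈ P.support, Function.update q s s' v = q v :=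
      fun v hv => Function.update_of_ne (hne v hv) _ _
    have hss' : s' ≠ s := hadj.ne'
    have hstart : s' ∈ P.support := P.start_mem_support
    have hold : ∀ a ∈ P.support, ∀ b ∈ P.support, ∃ L,
        ParentChain (Function.update q s s') a b L ∧ (∀ v ∈ L, v ∈ P.support) ∧
        (L.map fun v => spDist H len v (Function.update q s s' v)).sum ≤ spDist H len a b := by
      intro a ha b hb
      obtain ⟨L, hc, hLs, hw⟩ := hL a ha b hb
      refine ⟨L, hc.congr fun v hv => hagree v (hLs v hv), hLs, ?_⟩
      rwa [List.map_congr_left fun v hv => by rw [hagree v (hLs v hv)]]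
    have hnew : ∀ b ∈ P.support, ∃ L,
        ParentChain (Function.update q s s') s b L ∧
        (∀ v ∈ L, v ∈ (SimpleGraph.Walk.cons hadj P).support) ∧
        (L.map fun v => spDist H len v (Function.update q s s' v)).sum ≤ spDist H len s b := by
      intro b hb
      obtain ⟨L, hc, hLs, hw⟩ := hold s' hstart b hb
      refine ⟨s :: L, .up (by simpa using hss') (by simpa using hc), ?_, ?_⟩
      · intro v hv
        rcases List.mem_cons.1 hv with rfl | hv
        · simp
        · simp [hLs v hv]
      · have := key b hb
        simp only [List.map_cons, List.sum_cons, Function.update_self]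
        linarith
    refine ⟨Function.update q s s', Function.update r s (r s' + 1), ?_, ?_⟩
    · intro v hv
      rw [SimpleGraph.Walk.support_cons, List.mem_cons] at hv
      rcases hv with rfl | hv
      · simp [hstart, hss']
      · obtain ⟨h1, h2⟩ := hq v hv
        rw [hagree v hv, Function.update_of_ne (hne v hv), Function.update_of_ne (hne _ h1)]
        exact ⟨by simp [h1], h2⟩
    · intro a ha b hb
      rw [SimpleGraph.Walk.support_cons, List.mem_cons] at ha hb
      rcases ha with rfl | ha <;> rcases hb with rfl | hb
      · exact ⟨[], .nil _, by simp, by simpa using spDist_nonneg hlen _ _⟩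
      · exact hnew b hb
      · obtain ⟨L, hc, hLs, hw⟩ := hnew a ha
        refine ⟨L.reverse, hc.reverse, by simpa using hLs, ?_⟩
        rw [List.map_reverse, List.sum_reverse, spDist_comm]
        exact hw
      · obtain ⟨L, hc, hLs, hw⟩ := hold a ha b hb
        exact ⟨L, hc, fun v hv => by simp [hLs v hv], hw⟩

variable {t : ℕ} {X : Fin t → Finset V}

lemma walk_meets_bag (hedge : ∀ ⦃u v : V⦄, H.Adj u v → ∃ i, u ∈ X i ∧ v ∈ X i)
    (hint : ∀ (v : V) (i j l : Fin t), i ≤ j → j ≤ l → v ∈ X i → v ∈ X l → v ∈ X j)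
    {u v : V} (P : H.Walk u v) {i j l : Fin t} (hij : i ≤ j) (hjl : j ≤ l) (hu : u ∈ X i)
    (hv : v ∈ X l) : ∃ a ∈ P.support, a ∈ X j := by
  induction P generalizing i with
  | nil => exact ⟨_, by simp, hint _ _ _ _ hij hjl hu hv⟩
  | cons hadj P ih =>
    obtain ⟨m, hm, hm'⟩ := hedge hadj
    rcases le_total m j with h | h
    · obtain ⟨a, ha, haj⟩ := ih h hm' hv
      exact ⟨a, by simp [ha], haj⟩
    · exact ⟨_, by simp, hint _ _ _ _ hij h hu hm⟩

lemma exists_component_endpoints (X : Fin t → Finset V) (c : H.ConnectedComponent) :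
    ∃ u v : V, H.connectedComponentMk u = c ∧ H.connectedComponentMk v = c ∧
      ∀ j, ∀ x ∈ X j, H.connectedComponentMk x = c →
        ∃ i l, i ≤ j ∧ j ≤ l ∧ u ∈ X i ∧ v ∈ X l := by
  classical
  set I : Finset (Fin t) :=
    Finset.univ.filter fun i => ∃ x ∈ X i, H.connectedComponentMk x = c
  by_cases hne : I.Nonempty
  · obtain ⟨u, hu, huc⟩ := (Finset.mem_filter.1 (I.min'_mem hne)).2
    obtain ⟨v, hv, hvc⟩ := (Finset.mem_filter.1 (I.max'_mem hne)).2
    refine ⟨u, v, huc, hvc, fun j x hx hxc => ?_⟩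
    have hj : j ∈ I := Finset.mem_filter.2 ⟨Finset.mem_univ _, x, hx, hxc⟩
    exact ⟨_, _, I.min'_le j hj, I.le_max' j hj, hu, hv⟩
  · obtain ⟨u, rfl⟩ := c.exists_rep
    refine ⟨u, u, rfl, rfl, fun j x hx hxc => (hne ⟨j, ?_⟩).elim⟩
    exact Finset.mem_filter.2 ⟨Finset.mem_univ _, x, hx, hxc⟩

/-- In every component there is a geodesic meeting all bags that meet the component. -/
lemma exists_spine [Finite V] (hlen : ∀ e, 0 ≤ len e)
    (hedge : ∀ ⦃u v : V⦄, H.Adj u v → ∃ i, u ∈ X i ∧ v ∈ X i)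
    (hint : ∀ (v : V) (i j l : Fin t), i ≤ j → j ≤ l → v ∈ X i → v ∈ X l → v ∈ X j) :
    ∃ (A : Set V) (q : V → V) (r : V → ℕ),
      (∀ v, ∃ a ∈ A, H.Reachable v a) ∧
      (∀ i, (X i).Nonempty → ∃ a ∈ X i, a ∈ A) ∧
      (∀ a ∈ A, q a ∈ A ∧ H.Reachable a (q a) ∧ (q a ≠ a → r (q a) < r a)) ∧
      ∀ a ∈ A, ∀ b ∈ A, H.Reachable a b → ∃ L, ParentChain q a b L ∧ (∀ v ∈ L, v ∈ A) ∧
        (L.map fun v => spDist H len v (q v)).sum ≤ spDist H len a b := by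
  have hcomp : ∀ c : H.ConnectedComponent, ∃ (S : Set V) (q : V → V) (r : V → ℕ),
      (∀ v ∈ S, H.connectedComponentMk v = c) ∧ S.Nonempty ∧
      (∀ i, ∀ x ∈ X i, H.connectedComponentMk x = c → ∃ a ∈ X i, a ∈ S) ∧
      (∀ v ∈ S, q v ∈ S ∧ (q v ≠ v → r (q v) < r v)) ∧
      ∀ a ∈ S, ∀ b ∈ S, ∃ L, ParentChain q a b L ∧ (∀ v ∈ L, v ∈ S) ∧
        (L.map fun v => spDist H len v (q v)).sum ≤ spDist H len a b := by
    intro c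
    obtain ⟨u, v, hu, hv, hX⟩ := exists_component_endpoints X c
    obtain ⟨P, hP, hPd⟩ := exists_path_eq_spDist hlen
      (SimpleGraph.ConnectedComponent.exact (hu.trans hv.symm))
    obtain ⟨q, r, hq, hL⟩ := exists_parent_of_geodesic hlen P hP hPd
    refine ⟨{x | x ∈ P.support}, q, r, ?_, ⟨u, P.start_mem_support⟩, ?_, hq, hL⟩
    · intro x hx
      classical
      rw [← hu]
      exact (SimpleGraph.ConnectedComponent.sound ⟨P.takeUntil x hx⟩).symm
    · intro j x hx hxc
      obtain ⟨i, l, hij, hjl, hui, hvl⟩ := hX j x hx hxc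
      obtain ⟨a, ha, haj⟩ := walk_meets_bag hedge hint P hij hjl hui hvl
      exact ⟨a, haj, ha⟩
  choose S q r hS hne hX hq hL using hcomp
  let mk := H.connectedComponentMk
  have hmem : ∀ {c v}, v ∈ S c → v ∈ S (mk v) := fun {c v} hv => by
    rw [show mk v = c from hS c v hv]; exact hv
  refine ⟨{v | v ∈ S (mk v)}, fun v => q (mk v) v, fun v => r (mk v) v, ?_, ?_, ?_, ?_⟩
  · intro v
    obtain ⟨a, ha⟩ := hne (mk v)
    exact ⟨a, hmem ha, SimpleGraph.ConnectedComponent.exact (hS _ _ ha).symm⟩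
  · rintro i ⟨x, hx⟩
    obtain ⟨a, ha, haS⟩ := hX (mk x) i x hx rfl
    exact ⟨a, ha, hmem haS⟩
  · intro a ha
    obtain ⟨h1, h2⟩ := hq (mk a) a ha
    have h3 : mk (q (mk a) a) = mk a := hS _ _ h1
    refine ⟨hmem h1, SimpleGraph.ConnectedComponent.exact h3.symm, fun h => ?_⟩
    simp only [h3]
    exact h2 h
  · intro a ha b hb hab
    have hmk : mk b = mk a := (SimpleGraph.ConnectedComponent.sound hab).symm
    obtain ⟨L, hc, hLS, hw⟩ := hL (mk a) a ha b (by rw [← hmk]; exact hb)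
    have hv : ∀ v ∈ L, mk v = mk a := fun v hv => hS _ _ (hLS v hv)
    refine ⟨L, hc.congr fun v h => by rw [hv v h], fun v h => hmem (hLS v h), ?_⟩
    refine le_of_eq_of_le (congrArg List.sum (List.map_congr_left fun v h => ?_)) hw
    simp only [hv v h]

end Spine

section Cutting

lemma card_filter_div_lt_div_le (a m M : ℕ) :
    (Finset.univ.filter fun θ : Fin M => (a + θ) / M < (a + m + θ) / M).card ≤ m := by
  rcases Nat.eq_zero_or_pos M with rfl | hM
  · simp
  rcases le_total M m with hMm | hmM
  · exact (Finset.card_le_univ _).trans (by simpa using hMm)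
  calc _ ≤ (Finset.Ico (M - m) M).card := ?_
    _ = m := by rw [Nat.card_Ico]; omega
  refine Finset.card_le_card_of_injOn (fun θ => (a + θ) % M) ?_ ?_
  · intro θ hθ
    simp only [Finset.coe_filter, Finset.mem_univ, true_and, Set.mem_ofPred_eq] at hθ
    simp only [Finset.coe_Ico, Set.mem_Ico]
    refine ⟨?_, Nat.mod_lt _ hM⟩
    by_contra hlt
    have h1 := Nat.div_add_mod (a + θ) M
    have h2 : (a + m + θ) / M < (a + θ) / M + 1 := by
      rw [Nat.div_lt_iff_lt_mul hM, Nat.add_mul, Nat.mul_comm ((a + θ) / M)]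
      omega
    omega
  · intro θ _ θ' _ h
    have h' : a + θ ≡ a + θ' [MOD M] := h
    have := Nat.ModEq.add_left_cancel' a h'
    exact Fin.ext (this.eq_of_lt_of_lt θ.2 θ'.2)

lemma exists_potential {V : Type*} {par : V → V}
    (hr : ∃ rk : V → ℕ, ∀ v, par v ≠ v → rk (par v) < rk v) (m : V → ℕ) :
    ∃ φ : V → ℕ, ∀ v, par v ≠ v → φ v = φ (par v) + m v := by
  classical
  obtain ⟨rk, hrk⟩ := hr
  refine ⟨(measure rk).wf.fix fun v F =>
    if h : par v ≠ v then F (par v) (hrk v h) + m v else 0, fun v hv => ?_⟩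
  rw [WellFounded.fix_eq, dif_pos hv]

lemma exists_scaled_weight {M : ℕ} {e h : ℝ} (he : 0 ≤ e) (hh : 0 ≤ h)
    (hM : 0 < e → h ≤ M * e) :
    ∃ m : ℕ, (m < M → M * e ≤ m * h) ∧ (0 < h → m * h ≤ 2 * M * e) := by
  rcases he.eq_or_lt with rfl | he
  · exact ⟨0, by simp, by simp⟩
  rcases hh.eq_or_lt with rfl | hh
  · exact ⟨M, by simp, by simp⟩
  refine ⟨⌈M * e / h⌉₊, fun _ => ?_, fun _ => ?_⟩
  · rw [← div_le_iff₀ hh]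
    exact Nat.le_ceil _
  · have h1 : (⌈M * e / h⌉₊ : ℝ) < M * e / h + 1 := Nat.ceil_lt_add_one (by positivity)
    have h2 := mul_lt_mul_of_pos_right h1 hh
    rw [add_mul, div_mul_cancel₀ _ hh.ne'] at h2
    linarith [hM he]

variable {V : Type*} {par P : V → V} {h e W : V → ℝ} {φ m : V → ℕ} {M : ℕ}

lemma exists_chain_to_spine {A : Set V} {θ : ℕ} (hM : 0 < M)
    (hr : ∃ rk : V → ℕ, ∀ v, par v ≠ v → rk (par v) < rk v)
    (hh : ∀ v, 0 ≤ h v) (hlip : ∀ v, h (par v) ≤ h v + e v)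
    (hφ : ∀ v, par v ≠ v → φ v = φ (par v) + m v)
    (hm : ∀ v, m v < M → M * e v ≤ m v * min (h v) (h (par v)))
    (hP : ∀ v, v ∉ A → (P v ∈ A ∧ W v = h v) ∨
      (par v ≠ v ∧ P v = par v ∧ W v = e v ∧ (φ v + θ) / M ≤ (φ (par v) + θ) / M)) (v : V) :
    ∃ a ∈ A, ∃ L, ParentChain P v a L ∧ (L.map W).sum ≤ 5 * h v := by
  have hM' : (0 : ℝ) < M := by exact_mod_cast hM
  have hexp : ∀ n : ℕ, 1 ≤ Real.exp ((n : ℝ) / M) := fun n => Real.one_le_exp (by positivity)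
  suffices key : ∃ a ∈ A, ∃ L, ParentChain P v a L ∧
      (L.map W).sum ≤ (2 * Real.exp (((φ v + θ) % M : ℕ) / M) - 1) * h v by
    obtain ⟨a, ha, L, hL, hw⟩ := key
    refine ⟨a, ha, L, hL, hw.trans (mul_le_mul_of_nonneg_right ?_ (hh v))⟩
    have h1 : Real.exp (((φ v + θ) % M : ℕ) / M) ≤ Real.exp 1 := by
      rw [Real.exp_le_exp, div_le_one hM']
      exact_mod_cast (Nat.mod_lt _ hM).le
    linarith [Real.exp_one_lt_d9]
  obtain ⟨rk, hrk⟩ := hr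
  induction hn : rk v using Nat.strong_induction_on generalizing v with
  | _ n ih =>
  subst hn
  by_cases hvA : v ∈ A
  · refine ⟨v, hvA, [], .nil _, ?_⟩
    have := hexp ((φ v + θ) % M)
    simpa using mul_nonneg (by linarith) (hh v)
  rcases hP v hvA with ⟨hPv, hWv⟩ | ⟨hne, hPv, hWv, hdiv⟩
  · refine ⟨P v, hPv, [v], .up (fun hPv' => hvA (hPv' ▸ hPv)) (.nil _), ?_⟩
    have := hexp ((φ v + θ) % M)
    simpa [hWv] using le_mul_of_one_le_left (hh v) (by linarith)
  · obtain ⟨a, ha, L, hL, hw⟩ := ih _ (hrk v hne) (par v) rfl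
    refine ⟨a, ha, v :: L, .up (by rwa [hPv]) (by rwa [hPv]), ?_⟩
    have hφv := hφ v hne
    have hmod : (φ v + θ) % M = (φ (par v) + θ) % M + m v := by
      have h1 := Nat.div_add_mod (φ v + θ) M
      have h2 := Nat.div_add_mod (φ (par v) + θ) M
      have h3 : (φ (par v) + θ) / M ≤ (φ v + θ) / M := Nat.div_le_div_right (by omega)
      rw [le_antisymm hdiv h3] at h1
      omega
    have hlt : m v < M := by
      have := Nat.mod_lt (φ v + θ) hM
      omega
    have hE := hexp ((φ (par v) + θ) % M)
    rw [hmod, Nat.cast_add, add_div, Real.exp_add]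
    set E := Real.exp (((φ (par v) + θ) % M : ℕ) / M)
    have hev : e v ≤ m v / M * h v := by
      rw [div_mul_eq_mul_div, le_div_iff₀ hM', mul_comm]
      exact (hm v hlt).trans (mul_le_mul_of_nonneg_left (min_le_left _ _) (by positivity))
    have hx := Real.add_one_le_exp ((m v : ℝ) / M)
    rw [List.map_cons, List.sum_cons, hWv]
    calc e v + (L.map W).sum ≤ e v + (2 * E - 1) * (h v + e v) :=
          add_le_add le_rfl
            (hw.trans (mul_le_mul_of_nonneg_left (hlip v) (by linarith)))
      _ = (2 * E - 1) * h v + 2 * E * e v := by ring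
      _ ≤ (2 * E - 1) * h v + 2 * E * (m v / M * h v) := by gcongr
      _ = (2 * (E * (m v / M + 1)) - 1) * h v := by ring
      _ ≤ _ := by
        have := hh v
        gcongr

lemma card_filter_exists_le (hφ : ∀ v, par v ≠ v → φ v = φ (par v) + m v) (L : List V)
    (hL : ∀ v ∈ L, par v ≠ v) :
    (Finset.univ.filter fun θ : Fin M =>
      ∃ v ∈ L, (φ (par v) + θ) / M < (φ v + θ) / M).card ≤ (L.map m).sum := by
  classical
  induction L with
  | nil => simp
  | cons v L ih =>
    have h1 := ih fun u hu => hL u (by simp [hu])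
    have h2 := card_filter_div_lt_div_le (φ (par v)) (m v) M
    rw [← hφ v (hL v (by simp))] at h2
    have h3 : (Finset.univ.filter fun θ : Fin M =>
          ∃ u ∈ v :: L, (φ (par u) + θ) / M < (φ u + θ) / M) =
        (Finset.univ.filter fun θ : Fin M => (φ (par v) + θ) / M < (φ v + θ) / M) ∪
        (Finset.univ.filter fun θ : Fin M =>
          ∃ u ∈ L, (φ (par u) + θ) / M < (φ u + θ) / M) := by
      ext θ
      simp
    rw [h3, List.map_cons, List.sum_cons]
    exact (Finset.card_union_le _ _).trans (add_le_add h2 h1)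

lemma sum_le_of_detour {x y : V} {L : List V} (hL : ParentChain par x y L)
    (hh : ∀ v, 0 ≤ h v) (he : ∀ v, 0 ≤ e v) (hlip : ∀ v, |h v - h (par v)| ≤ e v)
    (hφ : ∀ v, par v ≠ v → φ v = φ (par v) + m v)
    (hm : ∀ v, 0 < min (h v) (h (par v)) → m v * min (h v) (h (par v)) ≤ 2 * M * e v)
    {l : ℝ} (hl : 0 ≤ l) {f : Fin M → ℝ}
    (hf : ∀ θ : Fin M, (∀ v ∈ L, (φ v + θ) / M ≤ (φ (par v) + θ) / M) → f θ ≤ (L.map e).sum)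
    (hf' : ∀ θ : Fin M, (∃ v ∈ L, (φ (par v) + θ) / M < (φ v + θ) / M) →
      f θ ≤ 20 * h x + 11 * l) :
    ∑ θ, f θ ≤ M * (81 * (L.map e).sum + 11 * l) := by
  classical
  set c := (L.map e).sum
  have hc0 : 0 ≤ c := List.sum_nonneg (by simpa using fun a _ => he a)
  have hx := hh x
  set B := Finset.univ.filter fun θ : Fin M =>
    ∃ v ∈ L, (φ (par v) + θ) / M < (φ v + θ) / M
  have hBM : (B.card : ℝ) ≤ M := by
    have := Finset.card_le_univ B
    rw [Fintype.card_fin] at this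
    exact_mod_cast this
  have hBh : B.card * h x ≤ 4 * M * c := by
    rcases le_or_gt (h x) (2 * c) with hcase | hcase
    · calc B.card * h x ≤ M * (2 * c) := by gcongr
        _ ≤ 4 * M * c := by nlinarith [mul_nonneg (Nat.cast_nonneg (α := ℝ) M) hc0]
    · have h1 : (B.card : ℝ) ≤ (L.map fun v => (m v : ℝ)).sum := by
        have := card_filter_exists_le (M := M) hφ L hL.par_ne
        have h2 : (B.card : ℝ) ≤ ((L.map m).sum : ℕ) := by exact_mod_cast this
        rwa [Nat.cast_list_sum, List.map_map] at h2
      calc B.card * h x ≤ (L.map fun v => (m v : ℝ)).sum * h x := by gcongr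
        _ = (L.map fun v => (m v : ℝ) * h x).sum := (List.sum_map_mul_right ..).symm
        _ ≤ (L.map fun v => 4 * M * e v).sum := by
          refine List.sum_le_sum fun v hv => ?_
          obtain ⟨h2, h3⟩ := hL.lipschitz_bound he hlip v hv
          have h4 : h x / 2 ≤ min (h v) (h (par v)) := le_min (by linarith) (by linarith)
          have h5 := hm v (by linarith)
          have h6 : (m v : ℝ) * (h x / 2) ≤ m v * min (h v) (h (par v)) := by gcongr
          linarith
        _ = 4 * M * c := List.sum_map_mul_left ..
  calc ∑ θ, f θ ≤ ∑ θ, (c + if θ ∈ B then 20 * h x + 11 * l else 0) := by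
        refine Finset.sum_le_sum fun θ _ => ?_
        split_ifs with hθ
        · linarith [hf' θ (Finset.mem_filter.1 hθ).2]
        · rw [add_zero]
          refine hf θ fun v hv => ?_
          by_contra hlt
          exact hθ (Finset.mem_filter.2 ⟨Finset.mem_univ _, v, hv, not_le.1 hlt⟩)
    _ = M * c + B.card * (20 * h x + 11 * l) := by
        rw [Finset.sum_add_distrib, Finset.sum_ite_mem]
        simp
        ring
    _ ≤ M * (81 * c + 11 * l) := by nlinarith [mul_le_mul_of_nonneg_right hBM hl]

end Cutting

section Peeling

variable {V : Type*} {H : SimpleGraph V} {len : Sym2 V → ℝ}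

lemma ParentChain.reachable {par : V → V} {x y : V} {L : List V} (h : ParentChain par x y L)
    (hr : ∀ v, H.Reachable v (par v)) : H.Reachable x y := by
  induction h with
  | nil => exact .rfl
  | up _ _ ih => exact (hr _).trans ih
  | down _ _ ih => exact (hr _).symm.trans ih

lemma ParentChain.spDist_le [Finite V] (hlen : ∀ e, 0 ≤ len e) {par : V → V} {x y : V}
    {L : List V} (h : ParentChain par x y L) (hr : ∀ v, H.Reachable v (par v)) :
    spDist H len x y ≤ (L.map fun v => spDist H len v (par v)).sum := by
  induction h with
  | nil => simp [spDist_self hlen]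
  | up _ hc ih =>
    rw [List.map_cons, List.sum_cons]
    exact (spDist_triangle hlen (hr _) (hc.reachable hr)).trans (add_le_add le_rfl ih)
  | down _ hc ih =>
    rw [List.map_cons, List.sum_cons]
    refine (spDist_triangle hlen (hr _).symm (hc.reachable hr)).trans (add_le_add ?_ ih)
    exact (spDist_comm _ _).le

/-- The graph `H` with all edges incident to `A` removed. -/
def isolate (H : SimpleGraph V) (A : Set V) : SimpleGraph V where
  Adj u v := H.Adj u v ∧ u ∉ A ∧ v ∉ A
  symm := ⟨fun _ _ h => ⟨h.1.symm, h.2.2, h.2.1⟩⟩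
  loopless := ⟨fun _ h => h.1.ne rfl⟩

lemma isolate_le (A : Set V) : isolate H A ≤ H := fun _ _ h => h.1

lemma notMem_of_isolate_reachable {A : Set V} {u v : V} (h : (isolate H A).Reachable u v)
    (hne : v ≠ u) : u ∉ A := by
  obtain ⟨p⟩ := h
  cases p with
  | nil => exact (hne rfl).elim
  | cons hadj _ => exact hadj.2.1

lemma exists_nearest [Finite V] {A : Set V} (hA : ∀ v, ∃ a ∈ A, H.Reachable v a) :
    ∃ near : V → V, ∀ v, near v ∈ A ∧ H.Reachable v (near v) ∧
      ∀ a ∈ A, H.Reachable v a → spDist H len v (near v) ≤ spDist H len v a := by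
  refine ⟨fun v => Classical.choose (Set.exists_min_image {a | a ∈ A ∧ H.Reachable v a}
    (spDist H len v) (Set.toFinite _) (hA v)), fun v => ?_⟩
  obtain ⟨⟨h1, h2⟩, h3⟩ := Classical.choose_spec (Set.exists_min_image
    {a | a ∈ A ∧ H.Reachable v a} (spDist H len v) (Set.toFinite _) (hA v))
  exact ⟨h1, h2, fun a ha hva => h3 a ⟨ha, hva⟩⟩

lemma HasRandomForest.of_isolate [Finite V] (hlen : ∀ e, 0 ≤ len e) {A : Set V} {q : V → V}
    {r : V → ℕ} (hA : ∀ v, ∃ a ∈ A, H.Reachable v a)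
    (hq : ∀ a ∈ A, q a ∈ A ∧ H.Reachable a (q a) ∧ (q a ≠ a → r (q a) < r a))
    (hqL : ∀ a ∈ A, ∀ b ∈ A, H.Reachable a b → ∃ L, ParentChain q a b L ∧ (∀ v ∈ L, v ∈ A) ∧
      (L.map fun v => spDist H len v (q v)).sum ≤ spDist H len a b)
    {D : ℝ} (hD : 0 ≤ D) (hF : HasRandomForest (isolate H A) len D) :
    HasRandomForest H len (81 * D + 11) := by
  classical
  obtain ⟨Ω, _, _, par, hpar, hstretch⟩ := hF
  obtain ⟨near, hnear⟩ := exists_nearest (len := len) hA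
  set h : V → ℝ := fun v => spDist H len v (near v)
  set e : Ω → V → ℝ := fun ω v => spDist H len v (par ω v)
  have hh : ∀ v, 0 ≤ h v := fun v => spDist_nonneg hlen _ _
  have he : ∀ ω v, 0 ≤ e ω v := fun ω v => spDist_nonneg hlen _ _
  have hhA : ∀ v ∈ A, h v = 0 := fun v hv =>
    le_antisymm (((hnear v).2.2 v hv .rfl).trans (spDist_self hlen v).le) (hh v)
  have hlip : ∀ {u v}, H.Reachable u v → h u ≤ spDist H len u v + h v := fun {u v} huv =>
    ((hnear u).2.2 _ (hnear v).1 (huv.trans (hnear v).2.1)).trans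
      (spDist_triangle hlen huv (hnear v).2.1)
  have hparH : ∀ ω v, H.Reachable v (par ω v) := fun ω v =>
    ((hpar ω).reachable v).mono (isolate_le A)
  have hlip1 : ∀ ω v, h v ≤ e ω v + h (par ω v) := fun ω v => hlip (hparH ω v)
  have hlip2 : ∀ ω v, h (par ω v) ≤ h v + e ω v := fun ω v => by
    have := hlip (hparH ω v).symm
    rw [spDist_comm] at this
    linarith
  have hlip3 : ∀ ω v, |h v - h (par ω v)| ≤ e ω v := fun ω v =>
    abs_le.2 ⟨by linarith [hlip2 ω v], by linarith [hlip1 ω v]⟩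
  obtain ⟨M, hM, hMe⟩ : ∃ M : ℕ, 0 < M ∧
      ∀ ω v, 0 < e ω v → min (h v) (h (par ω v)) ≤ M * e ω v := by
    obtain ⟨M, hM⟩ := Finite.exists_le fun p : Ω × V =>
      ⌈min (h p.2) (h (par p.1 p.2)) / e p.1 p.2⌉₊
    refine ⟨M + 1, M.succ_pos, fun ω v hpos => ?_⟩
    rw [← div_le_iff₀ hpos]
    refine (Nat.le_ceil _).trans ?_
    exact_mod_cast (hM (ω, v)).trans M.le_succ
  have hmexists := fun ω v =>
    exists_scaled_weight (he ω v) (le_min (hh v) (hh (par ω v))) (hMe ω v)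
  choose m hm hm' using hmexists
  choose φ hφ using fun ω => exists_potential (hpar ω).ranked (m ω)
  let keep : Ω → Fin M → V → Prop := fun ω θ v =>
    par ω v ≠ v ∧ (φ ω v + θ) / M ≤ (φ ω (par ω v) + θ) / M
  let P : Ω × Fin M → V → V := fun ω v =>
    if v ∈ A then q v else if keep ω.1 ω.2 v then par ω.1 v else near v
  have hPA : ∀ ω v, v ∈ A → P ω v = q v := fun ω v hv => if_pos hv
  have hPkeep : ∀ ω v, v ∉ A → keep ω.1 ω.2 v → P ω v = par ω.1 v := fun ω v hv hk => by
    simp only [P, if_neg hv, if_pos hk]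
  have hPcut : ∀ ω v, v ∉ A → ¬ keep ω.1 ω.2 v → P ω v = near v := fun ω v hv hk => by
    simp only [P, if_neg hv, if_neg hk]
  have hPreach : ∀ ω v, H.Reachable v (P ω v) := by
    intro ω v
    by_cases hv : v ∈ A
    · rw [hPA ω v hv]
      exact (hq v hv).2.1
    by_cases hk : keep ω.1 ω.2 v
    · rw [hPkeep ω v hv hk]
      exact hparH _ _
    · rw [hPcut ω v hv hk]
      exact (hnear v).2.1
  have hPforest : ∀ ω, IsParentForest H (P ω) := by
    intro ω
    refine ⟨hPreach ω, ?_⟩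
    obtain ⟨rk, hrk⟩ := (hpar ω.1).ranked
    obtain ⟨K, hK⟩ := Finite.exists_le r
    refine ⟨fun v => if v ∈ A then r v else K + 1 + rk v, fun v hne => ?_⟩
    by_cases hv : v ∈ A
    · obtain ⟨h1, -, h3⟩ := hq v hv
      rw [hPA ω v hv] at hne ⊢
      simpa [h1, hv] using h3 hne
    by_cases hPv : P ω v ∈ A
    · have := hK (P ω v)
      simp only [hPv, hv, if_true, if_false]
      omega
    · by_cases hk : keep ω.1 ω.2 v
      · rw [hPkeep ω v hv hk] at hPv ⊢
        simpa [hPv, hv] using hrk v hk.1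
      · rw [hPcut ω v hv hk] at hPv
        exact (hPv (hnear v).1).elim
  have hspine : ∀ ω v, ∃ a ∈ A, ∃ L, ParentChain (P ω) v a L ∧
      (L.map fun v => spDist H len v (P ω v)).sum ≤ 5 * h v := by
    intro ω v
    refine exists_chain_to_spine (par := par ω.1) (e := e ω.1) (φ := φ ω.1) (m := m ω.1)
      (θ := ω.2) hM (hpar ω.1).ranked hh (hlip2 ω.1) (hφ ω.1) (hm ω.1) (fun v hv => ?_) v
    by_cases hk : keep ω.1 ω.2 v
    · rw [hPkeep ω v hv hk]
      exact .inr ⟨hk.1, rfl, rfl, hk.2⟩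
    · rw [hPcut ω v hv hk]
      exact .inl ⟨(hnear v).1, rfl⟩
  have hdetour : ∀ ω x y, H.Reachable x y → ∃ L, ParentChain (P ω) x y L ∧
      (L.map fun v => spDist H len v (P ω v)).sum ≤
        10 * h x + 10 * h y + spDist H len x y := by
    intro ω x y hxy
    obtain ⟨a, ha, La, hLa, hwa⟩ := hspine ω x
    obtain ⟨b, hb, Lb, hLb, hwb⟩ := hspine ω y
    have hxa := hLa.reachable (hPreach ω)
    have hyb := hLb.reachable (hPreach ω)
    obtain ⟨L, hL, hLA, hw⟩ := hqL a ha b hb (hxa.symm.trans (hxy.trans hyb))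
    refine ⟨La ++ (L ++ Lb.reverse),
      hLa.append ((hL.congr fun v hv => hPA ω v (hLA v hv)).append hLb.reverse), ?_⟩
    have h1 := hLa.spDist_le hlen (hPreach ω)
    have h2 := hLb.spDist_le hlen (hPreach ω)
    have h3 := spDist_triangle hlen hxa.symm (hxy.trans hyb)
    have h4 := spDist_triangle hlen hxy hyb
    rw [spDist_comm a x] at h3
    have h5 : L.map (fun v => spDist H len v (P ω v)) = L.map fun v => spDist H len v (q v) :=
      List.map_congr_left fun v hv => by rw [hPA ω v (hLA v hv)]
    simp only [List.map_append, List.sum_append, List.map_reverse, List.sum_reverse, h5]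
    linarith
  have : Nonempty (Fin M) := ⟨⟨0, hM⟩⟩
  refine ⟨Ω × Fin M, inferInstance, inferInstance, P, hPforest, fun x y hxy => ?_⟩
  set l := len s(x, y)
  have hl : 0 ≤ l := hlen _
  have hdl : spDist H len x y ≤ l := spDist_le_of_adj hlen hxy
  have hxl := hlip hxy.reachable
  have hyl := hlip hxy.symm.reachable
  rw [spDist_comm] at hyl
  rw [Fintype.card_prod, Fintype.card_fin, Nat.cast_mul]
  by_cases hA' : x ∈ A ∨ y ∈ A
  · choose L hL hw using fun ω => hdetour ω x y hxy.reachable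
    refine ⟨L, hL, ?_⟩
    have hbound : ∀ ω, ((L ω).map fun v => spDist H len v (P ω v)).sum ≤ 11 * l := by
      intro ω
      have := hw ω
      rcases hA' with hx | hy
      · linarith [hhA x hx]
      · linarith [hhA y hy]
    calc _ ≤ ∑ _ω : Ω × Fin M, 11 * l := Finset.sum_le_sum fun ω _ => hbound ω
      _ = Fintype.card Ω * M * (11 * l) := by simp
      _ ≤ _ := by
        have := mul_nonneg hD hl
        gcongr
        linarith
  · push Not at hA'
    obtain ⟨L, hL, hw⟩ := hstretch x y ⟨hxy, hA'⟩
    have hLA : ∀ ω, ∀ v ∈ L ω, v ∉ A := fun ω v hv =>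
      notMem_of_isolate_reachable ((hpar ω).reachable v) ((hL ω).par_ne v hv)
    have hchoice : ∀ ω : Ω × Fin M, ∃ L', ParentChain (P ω) x y L' ∧
        ((∀ v ∈ L ω.1, (φ ω.1 v + ω.2) / M ≤ (φ ω.1 (par ω.1 v) + ω.2) / M) →
          (L'.map fun v => spDist H len v (P ω v)).sum ≤ ((L ω.1).map (e ω.1)).sum) ∧
        ((∃ v ∈ L ω.1, (φ ω.1 (par ω.1 v) + ω.2) / M < (φ ω.1 v + ω.2) / M) →
          (L'.map fun v => spDist H len v (P ω v)).sum ≤ 20 * h x + 11 * l) := by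
      intro ω
      by_cases hk : ∀ v ∈ L ω.1, (φ ω.1 v + ω.2) / M ≤ (φ ω.1 (par ω.1 v) + ω.2) / M
      · have hP : ∀ v ∈ L ω.1, P ω v = par ω.1 v := fun v hv =>
          hPkeep ω v (hLA _ v hv) ⟨(hL _).par_ne v hv, hk v hv⟩
        refine ⟨L ω.1, (hL ω.1).congr hP, fun _ => ?_, fun ⟨v, hv, hlt⟩ => ?_⟩
        · exact (congrArg List.sum (List.map_congr_left fun v hv => by rw [hP v hv])).le
        · exact (hlt.not_ge (hk v hv)).elim
      · obtain ⟨L', hL', hw'⟩ := hdetour ω x y hxy.reachable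
        exact ⟨L', hL', fun hk' => (hk hk').elim, fun _ => by linarith⟩
    choose L' hL' hkeep hcut using hchoice
    refine ⟨L', hL', ?_⟩
    have hle : ∀ ω, ((L ω).map (e ω)).sum ≤
        ((L ω).map fun v => spDist (isolate H A) len v (par ω v)).sum := fun ω =>
      List.sum_le_sum fun v _ => spDist_mono hlen (isolate_le A) ((hpar ω).reachable v)
    rw [Fintype.sum_prod_type]
    calc _ ≤ ∑ ω, M * (81 * ((L ω).map (e ω)).sum + 11 * l) :=
          Finset.sum_le_sum fun ω _ => sum_le_of_detour (hL ω) hh (he ω) (hlip3 ω) (hφ ω)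
            (hm' ω) hl (fun θ => hkeep (ω, θ)) (fun θ => hcut (ω, θ))
      _ = M * (81 * ∑ ω, ((L ω).map (e ω)).sum + Fintype.card Ω * (11 * l)) := by
          rw [← Finset.mul_sum, Finset.sum_add_distrib, ← Finset.mul_sum]
          simp
      _ ≤ M * (81 * (Fintype.card Ω * (D * l)) + Fintype.card Ω * (11 * l)) := by
          have := (Finset.sum_le_sum fun ω (_ : ω ∈ Finset.univ) => hle ω).trans hw
          gcongr
      _ = _ := by ring

/-- A graph covered by a linear sequence of bags of size at most `m + 1` has a random parent forest
of stretch `11 * (1 + 81 + ⋯ + 81 ^ (m - 1))`. -/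
lemma hasRandomForest_of_bags [Finite V] (hlen : ∀ e, 0 ≤ len e) {t : ℕ} (m : ℕ)
    (H : SimpleGraph V) (X : Fin t → Finset V)
    (hedge : ∀ ⦃u v : V⦄, H.Adj u v → ∃ i, u ∈ X i ∧ v ∈ X i)
    (hint : ∀ (v : V) (i j l : Fin t), i ≤ j → j ≤ l → v ∈ X i → v ∈ X l → v ∈ X j)
    (hcard : ∀ i, (X i).card ≤ m + 1) :
    HasRandomForest H len (11 / 80 * (81 ^ m - 1)) := by
  classical
  induction m generalizing H X with
  | zero =>
    refine ⟨Unit, inferInstance, inferInstance, fun _ => id,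
      fun _ => ⟨fun _ => .rfl, fun _ => 0, fun _ h => (h rfl).elim⟩, fun x y hxy => ?_⟩
    obtain ⟨i, hx, hy⟩ := hedge hxy
    exact (hxy.ne (Finset.card_le_one.1 (hcard i) x hx y hy)).elim
  | succ m ih =>
    obtain ⟨A, q, r, hA, hX, hq, hL⟩ := exists_spine hlen hedge hint
    have hD : (0 : ℝ) ≤ 11 / 80 * (81 ^ m - 1) := by
      have : (1 : ℝ) ≤ 81 ^ m := one_le_pow₀ (by norm_num)
      linarith
    have hF : HasRandomForest (isolate H A) len (11 / 80 * (81 ^ m - 1)) := by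
      refine ih (isolate H A) (fun i => (X i).filter (· ∉ A)) ?_ ?_ ?_
      · intro u v huv
        obtain ⟨i, hu, hv⟩ := hedge huv.1
        exact ⟨i, by simp [hu, huv.2.1], by simp [hv, huv.2.2]⟩
      · intro v i j l hij hjl hi hl
        simp only [Finset.mem_filter] at hi hl ⊢
        exact ⟨hint v i j l hij hjl hi.1 hl.1, hi.2⟩
      · intro i
        rcases (X i).eq_empty_or_nonempty with h | h
        · simp [h]
        · obtain ⟨a, ha, haA⟩ := hX i h
          have : ((X i).filter (· ∉ A)).card < (X i).card :=
            Finset.card_lt_card (Finset.filter_ssubset.2 ⟨a, ha, by simpa using haA⟩)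
          have := hcard i
          omega
    convert hF.of_isolate hlen hA hq hL hD using 1
    ring

end Peeling

section ParentGraph

variable {V : Type*}

/-- The graph whose edges join every vertex to its parent. -/
def parentGraph (par : V → V) : SimpleGraph V := SimpleGraph.fromRel fun u v => par u = v

/-- The distances of `G` as edge lengths. -/
noncomputable def distLength (G : SimpleGraph V) (len : Sym2 V → ℝ) : Sym2 V → ℝ :=
  Sym2.lift ⟨fun u v => spDist G len u v, fun u v => spDist_comm u v⟩

variable {G : SimpleGraph V} {len : Sym2 V → ℝ} {par : V → V}

lemma distLength_nonneg (hlen : ∀ e, 0 ≤ len e) (e : Sym2 V) : 0 ≤ distLength G len e := by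
  induction e with
  | _ u v => exact spDist_nonneg hlen u v

lemma distLength_mk (u v : V) : distLength G len s(u, v) = spDist G len u v := rfl

lemma ParentChain.exists_walk {x y : V} {L : List V} (h : ParentChain par x y L) :
    ∃ p : (parentGraph par).Walk x y, (p.edges.map (distLength G len)).sum =
      (L.map fun v => spDist G len v (par v)).sum := by
  induction h with
  | nil x => exact ⟨.nil, by simp⟩
  | @up x y L hx _ ih =>
    obtain ⟨p, hp⟩ := ih
    have hadj : (parentGraph par).Adj x (par x) :=
      (SimpleGraph.fromRel_adj _ _ _).2 ⟨hx.symm, .inl rfl⟩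
    exact ⟨.cons hadj p, by simp [hp, distLength_mk]⟩
  | @down x y L hx _ ih =>
    obtain ⟨p, hp⟩ := ih
    have hadj : (parentGraph par).Adj (par x) x :=
      (SimpleGraph.fromRel_adj _ _ _).2 ⟨hx, .inr rfl⟩
    refine ⟨.cons hadj p, ?_⟩
    simp [hp, distLength_mk, spDist_comm (par x) x]

lemma IsParentForest.isTree [Finite V] (h : IsParentForest G par)
    (hc : (parentGraph par).Connected) : (parentGraph par).IsTree := by
  classical
  have := Fintype.ofFinite V
  have := hc.nonempty
  rw [SimpleGraph.isTree_iff_connected_and_card]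
  refine ⟨hc, le_antisymm ?_ hc.card_vert_le_card_edgeSet_add_one⟩
  obtain ⟨rk, hrk⟩ := h.ranked
  obtain ⟨root, hroot⟩ := Finite.exists_min rk
  have hpr : par root = root := by
    by_contra hne
    exact (hrk root hne).not_ge (hroot _)
  have hsub : (parentGraph par).edgeSet ⊆
      ((Finset.univ.erase root).image fun v => s(v, par v) : Finset (Sym2 V)) := by
    intro e
    induction e with
    | _ u v =>
      intro he
      obtain ⟨hne, huv | huv⟩ := (SimpleGraph.fromRel_adj _ _ _).1 ((parentGraph par).mem_edgeSet.1 he)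
      · simp only [Finset.coe_image, Set.mem_image, Finset.mem_coe, Finset.mem_erase]
        exact ⟨u, ⟨fun hu => hne (by rw [← huv, hu, hpr]), Finset.mem_univ _⟩, by rw [huv]⟩
      · simp only [Finset.coe_image, Set.mem_image, Finset.mem_coe, Finset.mem_erase]
        exact ⟨v, ⟨fun hv => hne (by rw [← huv, hv, hpr]), Finset.mem_univ _⟩,
          by rw [huv, Sym2.eq_swap]⟩
  have h1 := Set.ncard_le_ncard hsub (Finset.finite_toSet _)
  rw [Set.ncard_coe_finset, ← Nat.card_coe_set_eq] at h1
  have h2 := Finset.card_image_le (s := Finset.univ.erase root) (f := fun v => s(v, par v))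
  rw [Finset.card_erase_of_mem (Finset.mem_univ _), Finset.card_univ] at h2
  have h3 : 0 < Fintype.card V := Fintype.card_pos
  rw [Nat.card_eq_fintype_card (α := V)]
  omega

lemma spDist_le_spDist_distLength [Finite V] (hlen : ∀ e, 0 ≤ len e) (hG : G.Connected)
    {T : SimpleGraph V} (hT : T.Connected) (x y : V) :
    spDist G len x y ≤ spDist T (distLength G len) x y := by
  obtain ⟨p, -, hp⟩ := exists_path_eq_spDist (distLength_nonneg (G := G) hlen) (hT x y)
  rw [← hp]
  clear hp
  induction p with
  | nil => simp [spDist_self hlen]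
  | cons _ _ ih =>
    rw [SimpleGraph.Walk.edges_cons, List.map_cons, List.sum_cons]
    exact (spDist_triangle hlen (hG _ _) (hG _ _)).trans (add_le_add le_rfl ih)

lemma HasRandomForest.stochEmbeds {n : ℕ} {G : SimpleGraph (Fin n)} {len : Sym2 (Fin n) → ℝ}
    (hlen : ∀ e, 0 ≤ len e) (hG : G.Connected) {D : ℝ} (hF : HasRandomForest G len D) :
    StochEmbeds (spDist G len) (SupportedMetrics TreeFam) D := by
  obtain ⟨Ω, _, _, par, hpar, hstretch⟩ := hF
  choose! L hL hw using hstretch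
  have hlenT := distLength_nonneg (G := G) hlen
  have hT : ∀ ω, (parentGraph (par ω)).Connected := by
    intro ω
    have := hG.nonempty
    refine ⟨fun x y => ?_⟩
    obtain ⟨p⟩ := hG x y
    induction p with
    | nil => exact .rfl
    | cons hadj _ ih =>
      obtain ⟨p, -⟩ := (hL _ _ hadj ω).exists_walk (G := G) (len := len)
      exact .trans ⟨p⟩ ih
  let dT : Ω → Fin n → Fin n → ℝ := fun ω => spDist (parentGraph (par ω)) (distLength G len)
  have hcard : (0 : ℝ) < Fintype.card Ω := by exact_mod_cast Fintype.card_pos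
  have hsum : ∀ x y, ∑ ω, dT ω x y ≤ Fintype.card Ω * (D * spDist G len x y) := by
    intro x y
    obtain ⟨p, -, hp⟩ := exists_path_eq_spDist hlen (hG x y)
    rw [← hp]
    clear hp
    induction p with
    | nil => simp [dT, spDist_self hlenT]
    | @cons u v w hadj p ih =>
      have h1 : ∑ ω, dT ω u v ≤ Fintype.card Ω * (D * len s(u, v)) := by
        refine (Finset.sum_le_sum fun ω _ => ?_).trans (hw _ _ hadj)
        obtain ⟨q, hq⟩ := (hL _ _ hadj ω).exists_walk (G := G) (len := len)
        exact (spDist_le_walk hlenT q).trans hq.le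
      calc ∑ ω, dT ω u w ≤ ∑ ω, (dT ω u v + dT ω v w) :=
            Finset.sum_le_sum fun ω _ => spDist_triangle hlenT (hT ω _ _) (hT ω _ _)
        _ = ∑ ω, dT ω u v + ∑ ω, dT ω v w := Finset.sum_add_distrib
        _ ≤ _ := add_le_add h1 ih
        _ = _ := by
          rw [SimpleGraph.Walk.edges_cons, List.map_cons, List.sum_cons]
          ring
  let E := (Fintype.equivFin Ω).symm
  refine ⟨Fintype.card Ω, fun _ => (Fintype.card Ω : ℝ)⁻¹, fun i => ⟨n, dT (E i)⟩,
    fun _ => id, fun _ => by positivity, ?_, fun i _ => ?_, fun i _ x y => ?_, fun x y => ?_⟩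
  · simp [hcard.ne']
  · exact ⟨parentGraph (par (E i)), (hpar _).isTree (hT _), hT _, distLength G len, hlenT,
      fun _ _ => rfl⟩
  · exact spDist_le_spDist_distLength hlen hG (hT _) x y
  · rw [← Finset.mul_sum, inv_mul_le_iff₀ hcard]
    exact (E.sum_comp fun ω => dT ω x y).trans_le (hsum x y)

end ParentGraph

lemma StochEmbeds.mono {n : ℕ} {d : Fin n → Fin n → ℝ} (hd : ∀ x y, 0 ≤ d x y)
    {𝒴 : Set FinMetric} {D D' : ℝ} (h : StochEmbeds d 𝒴 D) (hD : D ≤ D') :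
    StochEmbeds d 𝒴 D' := by
  obtain ⟨N, p, Y, F, h1, h2, h3, h4, h5⟩ := h
  exact ⟨N, p, Y, F, h1, h2, h3, h4,
    fun x y => (h5 x y).trans (mul_le_mul_of_nonneg_right hD (hd x y))⟩

lemma stretch_le {k : ℕ} (hk : 1 ≤ k) :
    (11 / 80 * (81 ^ k - 1) : ℝ) ≤
      (k + 1 : ℝ) * (4 * (k : ℝ)) ^ (k * (Nat.choose (k + 1) 2 + 1)) := by
  rcases hk.eq_or_lt with rfl | hk
  · norm_num [Nat.choose]
  have hk2 : (2 : ℝ) ≤ k := by exact_mod_cast hk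
  have hchoose : 3 ≤ Nat.choose (k + 1) 2 := Nat.choose_le_choose 2 (show 3 ≤ k + 1 by omega)
  have h1 : (81 : ℝ) ^ k ≤ (4 * (k : ℝ)) ^ (k * (Nat.choose (k + 1) 2 + 1)) := by
    calc (81 : ℝ) ^ k ≤ (8 ^ 4) ^ k := by gcongr; norm_num
      _ = 8 ^ (k * 4) := by rw [← pow_mul, mul_comm]
      _ ≤ 8 ^ (k * (Nat.choose (k + 1) 2 + 1)) :=
        pow_le_pow_right₀ (by norm_num) (Nat.mul_le_mul_left k (by omega))
      _ ≤ _ := by gcongr; linarith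
  have h2 : (0 : ℝ) < 81 ^ k := by positivity
  nlinarith

/-- **Theorem.** For every `k ≥ 1`, every shortest-path metric supported on a graph of
pathwidth at most `k` admits a stochastic `D`-embedding into the shortest-path metrics
supported on trees, with `D ≤ (k+1) · (4k)^(k · (C(k+1,2) + 1))`, i.e. `D ≤ O(k)^{O(k³)}`. -/
theorem pathwidth_into_trees_quantitative (k : ℕ) (hk : 1 ≤ k) :
    ∀ Y ∈ SupportedMetrics (PathwidthFam k),
      StochEmbeds Y.2 (SupportedMetrics TreeFam)
        ((k + 1 : ℝ) * (4 * (k : ℝ)) ^ (k * (Nat.choose (k + 1) 2 + 1))) := by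
  rintro ⟨n, d⟩ ⟨G, ⟨t, X, ⟨-, hedge, hint⟩, hcard⟩, hG, len, hlen, hd⟩
  have hd' : d = spDist G len := funext fun u => funext fun v => hd u v
  change StochEmbeds d _ _
  rw [hd']
  exact ((hasRandomForest_of_bags hlen k G X hedge hint hcard).stochEmbeds hlen hG).mono
    (spDist_nonneg hlen) (stretch_le hk)
end

section
/- Let G_1, G_2, G_3 be connected graphs, each of pathwidth exactly k, with pairwise disjoint vertex sets, and for i ∈ {1,2,3} let v_i ∈ V(G_i). Let G be the graph obtained by introducing a new vertex v* and joining it to v_1, v_2 and v_3; formally V(G) = {v*} ∪ V(G_1) ∪ V(G_2) ∪ V(G_3) and E(G) = E(G_1) ∪ E(G_2) ∪ E(G_3) ∪ {{v*,v_1},{v*,v_2},{v*,v_3}}. Then G has pathwidth exactly k+1. -/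
open scoped BigOperators

/-- The graph obtained from `G₁`, `G₂`, `G₃` (on disjoint vertex sets) by introducing a new
vertex `v* = none` joined to `v₁`, `v₂` and `v₃`. -/
def threeJoin {V₁ V₂ V₃ : Type*} (G₁ : SimpleGraph V₁) (G₂ : SimpleGraph V₂)
    (G₃ : SimpleGraph V₃) (v₁ : V₁) (v₂ : V₂) (v₃ : V₃) :
    SimpleGraph (Option (V₁ ⊕ V₂ ⊕ V₃)) :=
  SimpleGraph.fromRel fun x y =>
    match x, y with
    | some (Sum.inl a), some (Sum.inl b) => G₁.Adj a b
    | some (Sum.inr (Sum.inl a)), some (Sum.inr (Sum.inl b)) => G₂.Adj a b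
    | some (Sum.inr (Sum.inr a)), some (Sum.inr (Sum.inr b)) => G₃.Adj a b
    | none, some (Sum.inl a) => a = v₁
    | none, some (Sum.inr (Sum.inl a)) => a = v₂
    | none, some (Sum.inr (Sum.inr a)) => a = v₃
    | _, _ => False

theorem IsPathDecomp.exists_mem_support {V : Type*} {G : SimpleGraph V} {t : ℕ}
    {X : Fin t → Finset V} (hX : IsPathDecomp G t X) {u v : V} (p : G.Walk u v)
    {i j l : Fin t} (hij : i ≤ j) (hjl : j ≤ l) (hu : u ∈ X i) (hv : v ∈ X l) :
    ∃ w ∈ p.support, w ∈ X j := by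
  induction p generalizing i with
  | nil => exact ⟨_, by simp, hX.2.2 _ i j l hij hjl hu hv⟩
  | @cons u w v h p ih =>
    obtain ⟨m, hum, hwm⟩ := hX.2.1 h
    rcases le_total m j with hm | hm
    · obtain ⟨x, hx, hxj⟩ := ih hm hwm hv
      exact ⟨x, by simp [hx], hxj⟩
    · exact ⟨u, by simp, hX.2.2 u i j m hij hm hu hum⟩

theorem IsPathDecomp.comap {V W : Type*} {G : SimpleGraph V} {H : SimpleGraph W} {t : ℕ}
    {X : Fin t → Finset W} (hX : IsPathDecomp H t X) (f : G →g H) (hf : Function.Injective f) :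
    IsPathDecomp G t fun i => (X i).preimage f hf.injOn := by
  refine ⟨fun v => ?_, fun u v h => ?_, fun v i j l hij hjl hi hl => ?_⟩
  · simpa using hX.1 (f v)
  · simpa using hX.2.1 (f.map_adj h)
  · simp only [Finset.mem_preimage] at *
    exact hX.2.2 _ i j l hij hjl hi hl

theorem pathwidthLE_pathwidth {V : Type*} [Fintype V] (G : SimpleGraph V) :
    pathwidthLE G (pathwidth G) := by
  refine Nat.sInf_mem (s := {k | pathwidthLE G k})
    ⟨Fintype.card V, 1, fun _ => Finset.univ, ⟨?_, ?_, ?_⟩, ?_⟩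
  · simp
  · simp
  · simp
  · simp

/-- A path decomposition whose bags have at most `pathwidth G + 1` vertices has, for every copy
of `G`, a nonempty bag lying inside that copy. -/
theorem IsPathDecomp.exists_bag_subset_range {V W : Type*} [Nonempty V] {G : SimpleGraph V}
    {H : SimpleGraph W} {t : ℕ} {X : Fin t → Finset W} (hX : IsPathDecomp H t X)
    (hcard : ∀ i, (X i).card ≤ pathwidth G + 1) (f : G →g H) (hf : Function.Injective f) :
    ∃ i, (X i).Nonempty ∧ (X i : Set W) ⊆ Set.range f := by
  classical
  have hY := hX.comap f hf
  obtain ⟨i, hi⟩ : ∃ i, pathwidth G + 1 ≤ ((X i).preimage f hf.injOn).card := by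
    by_contra! hlt
    rcases hk : pathwidth G with _ | m
    · obtain ⟨i, hi⟩ := hY.1 (Classical.arbitrary V)
      have h₁ : ((X i).preimage f hf.injOn).card < pathwidth G + 1 := hlt i
      have h₂ : 0 < ((X i).preimage f hf.injOn).card := Finset.card_pos.2 ⟨_, hi⟩
      omega
    · have hle : pathwidth G ≤ m :=
        Nat.sInf_le (s := {k | pathwidthLE G k}) ⟨t, _, hY, fun i => by
          have : ((X i).preimage f hf.injOn).card < pathwidth G + 1 := hlt i
          omega⟩
      omega
  have hsub : ((X i).preimage f hf.injOn).image f ⊆ X i := by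
    simp [Finset.image_subset_iff]
  have heq := Finset.eq_of_subset_of_card_le hsub (by
    rw [Finset.card_image_of_injective _ hf]
    exact (hcard i).trans hi)
  refine ⟨i, ?_, ?_⟩
  · rw [← heq, Finset.image_nonempty, ← Finset.card_pos]
    omega
  · rw [← heq, Finset.coe_image]
    exact Set.image_subset_range _ _

/-- Three sets that are each linked to a common vertex `c`, every one avoiding the other two and
`c`, cannot all contain a bag of a path decomposition. -/
theorem IsPathDecomp.not_three_bags {W : Type*} {H : SimpleGraph W} {t : ℕ}
    {X : Fin t → Finset W} (hX : IsPathDecomp H t X) {c : W} {S : Fin 3 → Set W}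
    (hdisj : Pairwise fun a b => Disjoint (S a) (S b)) (hc : ∀ a, c ∉ S a)
    (hwalk : ∀ a, ∀ x ∈ S a, ∃ p : H.Walk x c, ∀ y ∈ p.support, y ∈ S a ∨ y = c)
    {j : Fin 3 → Fin t} (hne : ∀ a, (X (j a)).Nonempty)
    (hsub : ∀ a, (X (j a) : Set W) ⊆ S a) : False := by
  have key : ∀ a b d : Fin 3, a ≠ b → d ≠ b → j a ≤ j b → j b ≤ j d → False := by
    intro a b d hab hdb h₁ h₂
    obtain ⟨x, hx⟩ := hne a
    obtain ⟨y, hy⟩ := hne d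
    obtain ⟨p, hp⟩ := hwalk a x (hsub a hx)
    obtain ⟨q, hq⟩ := hwalk d y (hsub d hy)
    obtain ⟨w, hw, hwb⟩ := hX.exists_mem_support (p.append q.reverse) h₁ h₂ hx hy
    have hwS := hsub b hwb
    rw [SimpleGraph.Walk.mem_support_append_iff, SimpleGraph.Walk.support_reverse,
      List.mem_reverse] at hw
    have hwc : w ≠ c := fun h => hc b (h ▸ hwS)
    rcases hw with hw | hw
    · exact Set.disjoint_left.1 (hdisj hab) ((hp w hw).resolve_right hwc) hwS
    · exact Set.disjoint_left.1 (hdisj hdb) ((hq w hw).resolve_right hwc) hwS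
  have k₁ := key 0 1 2 (by decide) (by decide)
  have k₂ := key 2 1 0 (by decide) (by decide)
  have k₃ := key 1 0 2 (by decide) (by decide)
  have k₄ := key 2 0 1 (by decide) (by decide)
  have k₅ := key 0 2 1 (by decide) (by decide)
  have k₆ := key 1 2 0 (by decide) (by decide)
  have := le_total (j 0) (j 1)
  have := le_total (j 0) (j 2)
  have := le_total (j 1) (j 2)
  tauto

theorem SimpleGraph.Connected.exists_walk_map {V W : Type*} {G : SimpleGraph V}
    {H : SimpleGraph W} (hG : G.Connected) (f : G →g H) {v : V} {c : W} (h : H.Adj c (f v)) :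
    ∀ x ∈ Set.range f, ∃ p : H.Walk x c, ∀ y ∈ p.support, y ∈ Set.range f ∨ y = c := by
  rintro _ ⟨a, rfl⟩
  obtain ⟨p⟩ := hG.preconnected a v
  refine ⟨(p.map f).concat h.symm, fun y hy => ?_⟩
  simp only [SimpleGraph.Walk.support_concat, SimpleGraph.Walk.support_map,
    List.mem_append, List.mem_map, List.mem_singleton] at hy
  rcases hy with ⟨b, -, rfl⟩ | rfl
  · exact Or.inl ⟨b, rfl⟩
  · exact Or.inr rfl

theorem pathwidthLE.sum {V W : Type*} {G : SimpleGraph V} {H : SimpleGraph W} {k : ℕ}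
    (hG : pathwidthLE G k) (hH : pathwidthLE H k) : pathwidthLE (G ⊕g H) k := by
  obtain ⟨t, X, hX, hXk⟩ := hG
  obtain ⟨s, Y, hY, hYk⟩ := hH
  refine ⟨t + s, Fin.addCases (fun i => (X i).map Function.Embedding.inl)
    (fun i => (Y i).map Function.Embedding.inr), ⟨?_, ?_, ?_⟩, ?_⟩
  · rintro (v | v)
    · obtain ⟨i, hi⟩ := hX.1 v
      exact ⟨Fin.castAdd s i, by simpa using hi⟩
    · obtain ⟨i, hi⟩ := hY.1 v
      exact ⟨Fin.natAdd t i, by simpa using hi⟩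
  · rintro (u | u) (v | v) h
    · obtain ⟨i, hi⟩ := hX.2.1 (show G.Adj u v by simpa using h)
      exact ⟨Fin.castAdd s i, by simpa using hi⟩
    · simp at h
    · simp at h
    · obtain ⟨i, hi⟩ := hY.2.1 (show H.Adj u v by simpa using h)
      exact ⟨Fin.natAdd t i, by simpa using hi⟩
  · intro v i j l hij hjl hi hl
    induction i using Fin.addCases <;> induction j using Fin.addCases <;>
      induction l using Fin.addCases <;> rcases v with v | v <;>
      simp only [Fin.le_def, Fin.val_castAdd, Fin.val_natAdd, Fin.addCases_left,
        Fin.addCases_right, Finset.mem_map, Function.Embedding.inl_apply,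
        Function.Embedding.inr_apply, Sum.inl.injEq, Sum.inr.injEq, reduceCtorEq, and_false,
        exists_false, exists_eq_right, add_le_add_iff_left] at hij hjl hi hl ⊢
    · exact hX.2.2 v _ _ _ hij hjl hi hl
    · omega
    · omega
    · exact hY.2.2 v _ _ _ hij hjl hi hl
  · intro i
    induction i using Fin.addCases <;> simp [hXk, hYk]

theorem pathwidthLE.of_comap_some {V : Type*} [Nonempty V] {H : SimpleGraph (Option V)} {k : ℕ}
    (h : pathwidthLE (H.comap some) k) : pathwidthLE H (k + 1) := by
  obtain ⟨t, X, hX, hXk⟩ := h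
  refine ⟨t, fun i => Finset.insertNone (X i), ⟨?_, ?_, ?_⟩, ?_⟩
  · rintro (_ | v)
    · obtain ⟨i, -⟩ := hX.1 (Classical.arbitrary V)
      exact ⟨i, by simp⟩
    · simpa using hX.1 v
  · rintro (_ | u) (_ | v) huv
    · exact absurd huv (H.loopless.irrefl _)
    · simpa using hX.1 v
    · simpa using hX.1 u
    · simpa using hX.2.1 (show (H.comap some).Adj u v from huv)
  · rintro (_ | v) i j l hij hjl hi hl
    · simp
    · simp only [Finset.some_mem_insertNone] at *
      exact hX.2.2 v i j l hij hjl hi hl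
  · intro i
    simpa [Finset.card_insertNone] using hXk i

theorem comap_some_threeJoin {V₁ V₂ V₃ : Type*} (G₁ : SimpleGraph V₁) (G₂ : SimpleGraph V₂)
    (G₃ : SimpleGraph V₃) (v₁ : V₁) (v₂ : V₂) (v₃ : V₃) :
    (threeJoin G₁ G₂ G₃ v₁ v₂ v₃).comap some = G₁ ⊕g (G₂ ⊕g G₃) := by
  ext x y
  rcases x with x | x | x <;> rcases y with y | y | y <;>
    simp [threeJoin, SimpleGraph.adj_comm] <;> exact SimpleGraph.Adj.ne

/-- **Lemma.** If `G₁`, `G₂`, `G₃` are connected graphs of pathwidth exactly `k` on disjoint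
vertex sets, `vᵢ ∈ V(Gᵢ)`, and `G` is obtained by joining a new vertex `v*` to `v₁, v₂, v₃`,
then `G` has pathwidth exactly `k + 1`. -/
theorem pathwidth_threeJoin {V₁ V₂ V₃ : Type} [Fintype V₁] [Fintype V₂] [Fintype V₃]
    (G₁ : SimpleGraph V₁) (G₂ : SimpleGraph V₂) (G₃ : SimpleGraph V₃)
    (v₁ : V₁) (v₂ : V₂) (v₃ : V₃) (k : ℕ)
    (hc₁ : G₁.Connected) (hc₂ : G₂.Connected) (hc₃ : G₃.Connected)
    (hp₁ : pathwidth G₁ = k) (hp₂ : pathwidth G₂ = k) (hp₃ : pathwidth G₃ = k) :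
    pathwidth (threeJoin G₁ G₂ G₃ v₁ v₂ v₃) = k + 1 := by
  have := hc₁.nonempty
  have := hc₂.nonempty
  have := hc₃.nonempty
  set H := threeJoin G₁ G₂ G₃ v₁ v₂ v₃ with hH
  have hcomap : H.comap some = G₁ ⊕g (G₂ ⊕g G₃) := comap_some_threeJoin ..
  have hadj : ∀ x y, (G₁ ⊕g (G₂ ⊕g G₃)).Adj x y → H.Adj (some x) (some y) := by
    intro x y h
    rwa [← hcomap] at h
  apply le_antisymm
  · refine Nat.sInf_le (s := {k | pathwidthLE H k}) (pathwidthLE.of_comap_some ?_)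
    rw [hcomap]
    exact (hp₁ ▸ pathwidthLE_pathwidth G₁).sum
      ((hp₂ ▸ pathwidthLE_pathwidth G₂).sum (hp₃ ▸ pathwidthLE_pathwidth G₃))
  · by_contra! hlt
    obtain ⟨t, X, hX, hXk⟩ := pathwidthLE_pathwidth H
    have hcard : ∀ i, (X i).card ≤ k + 1 := fun i => (hXk i).trans (by omega)
    let f₁ : G₁ →g H := ⟨fun a => some (Sum.inl a), fun h => hadj _ _ (by simpa using h)⟩
    let f₂ : G₂ →g H :=
      ⟨fun a => some (Sum.inr (Sum.inl a)), fun h => hadj _ _ (by simpa using h)⟩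
    let f₃ : G₃ →g H :=
      ⟨fun a => some (Sum.inr (Sum.inr a)), fun h => hadj _ _ (by simpa using h)⟩
    obtain ⟨j₁, hn₁, hs₁⟩ := hX.exists_bag_subset_range (hp₁ ▸ hcard) f₁
      (fun a b h => by simpa [f₁] using h)
    obtain ⟨j₂, hn₂, hs₂⟩ := hX.exists_bag_subset_range (hp₂ ▸ hcard) f₂
      (fun a b h => by simpa [f₂] using h)
    obtain ⟨j₃, hn₃, hs₃⟩ := hX.exists_bag_subset_range (hp₃ ▸ hcard) f₃
      (fun a b h => by simpa [f₃] using h)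
    have ha₁ : H.Adj none (f₁ v₁) := by simp [hH, threeJoin, f₁]
    have ha₂ : H.Adj none (f₂ v₂) := by simp [hH, threeJoin, f₂]
    have ha₃ : H.Adj none (f₃ v₃) := by simp [hH, threeJoin, f₃]
    refine hX.not_three_bags (c := none)
      (S := ![Set.range f₁, Set.range f₂, Set.range f₃]) (j := ![j₁, j₂, j₃]) ?_ ?_ ?_ ?_ ?_
    · intro a b hab
      fin_cases a <;> fin_cases b <;>
        simp [Set.disjoint_left, f₁, f₂, f₃] at hab ⊢
    · intro a
      fin_cases a <;> simp [f₁, f₂, f₃]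
    · intro a
      fin_cases a
      exacts [hc₁.exists_walk_map f₁ ha₁, hc₂.exists_walk_map f₂ ha₂,
        hc₃.exists_walk_map f₃ ha₃]
    · intro a
      fin_cases a
      exacts [hn₁, hn₂, hn₃]
    · intro a
      fin_cases a
      exacts [hs₁, hs₂, hs₃]
end

section
/- For each integer i ≥ 1 and each m ≥ 3^{2^i}, the tree Ψ_{i,m} has pathwidth exactly i+1. -/
open scoped BigOperators

/-- `sc m = ⌈√m⌉`. -/
noncomputable def sc (m : ℝ) : ℕ := ⌈Real.sqrt m⌉₊

/-- Non-root vertices of the tree `Ψ_{i,m,l}` with `l` top-level legs: `Ψ_{i,m}` consists of a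
copy of the spider `Φ_{⌈√m⌉}` (a root with `⌈√m⌉` legs, each a path with `⌈√m⌉` edges) with a
copy of `Ψ_{i-1,√m}` rooted at each of its leaves.  `Sum.inl (j, p)` is the `p`-th vertex on
the `j`-th leg; `Sum.inr (j, c)` is a non-root vertex of the copy of `Ψ_{i-1,√m}` hanging at
the leaf of leg `j`. -/
noncomputable def PsiC : ℕ → ℝ → ℕ → Type
  | 0, _, _ => Empty
  | (i + 1), m, l =>
      (Fin l × Fin (sc m)) ⊕ (Fin l × PsiC i (Real.sqrt m) (sc (Real.sqrt m)))

/-- The adjacency relation of the tree `Ψ_{i,m,l}`; `none` is the root. -/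
noncomputable def PsiRel : (i : ℕ) → (m : ℝ) → (l : ℕ) →
    Option (PsiC i m l) → Option (PsiC i m l) → Prop
  | 0, _, _, _, _ => False
  | (i + 1), m, l, x, y =>
      match x, y with
      | none, some (Sum.inl (_, p)) => (p : ℕ) = 0
      | some (Sum.inl (j, p)), some (Sum.inl (j', p')) =>
          j = j' ∧ (p : ℕ) + 1 = (p' : ℕ)
      | some (Sum.inl (j, p)), some (Sum.inr (j', c)) =>
          j = j' ∧ (p : ℕ) + 1 = sc m ∧
            PsiRel i (Real.sqrt m) (sc (Real.sqrt m)) none (some c)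
      | some (Sum.inr (j, c)), some (Sum.inr (j', c')) =>
          j = j' ∧ PsiRel i (Real.sqrt m) (sc (Real.sqrt m)) (some c) (some c')
      | _, _ => False

/-- The unit-weighted tree `Ψ_{i,m,l}` (`Ψ_{i,m} = PsiGraph i m (sc m)`, and
`Ψ_{i,m,ℓ} = PsiGraph i m ⌈ℓ⌉` keeps only `⌈ℓ⌉` of the root's legs). -/
noncomputable def PsiGraph (i : ℕ) (m : ℝ) (l : ℕ) : SimpleGraph (Option (PsiC i m l)) :=
  SimpleGraph.fromRel (PsiRel i m l)

variable {V W : Type*}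

theorem pathwidthLE.mono {G : SimpleGraph V} {k l : ℕ} (h : pathwidthLE G k) (hkl : k ≤ l) :
    pathwidthLE G l := by
  obtain ⟨t, X, hX, hc⟩ := h
  exact ⟨t, X, hX, fun i => (hc i).trans (by omega)⟩

/-- Bags indexed by an arbitrary finite linear order bound the pathwidth. -/
theorem pathwidthLE_of_linearOrder {ι : Type*} [LinearOrder ι] [Finite ι] {G : SimpleGraph V}
    {k : ℕ} (X : ι → Finset V) (hv : ∀ v, ∃ i, v ∈ X i)
    (he : ∀ ⦃u v⦄, G.Adj u v → ∃ i, u ∈ X i ∧ v ∈ X i)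
    (hi : ∀ (v : V) (i j l : ι), i ≤ j → j ≤ l → v ∈ X i → v ∈ X l → v ∈ X j)
    (hc : ∀ i, (X i).card ≤ k + 1) : pathwidthLE G k := by
  have := Fintype.ofFinite ι
  let e := Fintype.orderIsoFinOfCardEq ι rfl
  refine ⟨Fintype.card ι, fun a => X (e a),
    ⟨fun v => ?_, fun u v h => ?_, fun v a b c hab hbc => ?_⟩, fun a => hc _⟩
  · obtain ⟨i, h⟩ := hv v
    exact ⟨e.symm i, by simpa using h⟩
  · obtain ⟨i, h⟩ := he h
    exact ⟨e.symm i, by simpa using h⟩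
  · exact hi v _ _ _ (e.monotone hab) (e.monotone hbc)

/-- A path decomposition pulls back along an injective graph homomorphism. -/
theorem IsPathDecomp.preimage {G : SimpleGraph V} {H : SimpleGraph W} {t : ℕ}
    {X : Fin t → Finset V} (hX : IsPathDecomp G t X) (f : H →g G) (hf : Function.Injective f) :
    IsPathDecomp H t fun i => (X i).preimage f hf.injOn := by
  refine ⟨fun v => ?_, fun u v h => ?_, fun v i j l hij hjl => ?_⟩
  · simpa using hX.1 (f v)
  · simpa using hX.2.1 (f.map_adj h)
  · simpa using hX.2.2 (f v) i j l hij hjl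

/-- The bags met by a connected graph mapping into `G` form an interval. -/
theorem IsPathDecomp.exists_mem_of_preconnected {G : SimpleGraph V} {H : SimpleGraph W} {t : ℕ}
    {X : Fin t → Finset V} (hX : IsPathDecomp G t X) (f : H →g G) (hH : H.Preconnected)
    {u w : W} {i j l : Fin t} (hij : i ≤ j) (hjl : j ≤ l) (hu : f u ∈ X i) (hw : f w ∈ X l) :
    ∃ s, f s ∈ X j := by
  by_contra! h
  have step : ∀ v (a : Fin t), a < j → f v ∈ X a → ∀ b, f v ∈ X b → b < j := by
    intro v a ha hva b hvb
    by_contra! hb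
    exact h v (hX.2.2 _ a j b ha.le hb hva hvb)
  have key : ∀ {x y}, H.Walk x y → (∀ b, f x ∈ X b → b < j) → ∀ b, f y ∈ X b → b < j := by
    intro x y p
    induction p with
    | nil => exact id
    | cons hadj _ ih =>
      intro hx
      obtain ⟨q, hq, hq'⟩ := hX.2.1 (f.map_adj hadj)
      exact ih (step _ q (hx q hq) hq')
  have hij' : i < j := lt_of_le_of_ne hij fun e => h u (e ▸ hu)
  obtain ⟨p⟩ := hH u w
  exact absurd (key p (step u i hij' hu) l hw) (not_lt.mpr hjl)

/-- If `G` carries a labelling `leg` with three labels whose complements are connected, and each of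
these three parts contains a copy of a graph of pathwidth more than `k`, then `G` has pathwidth
more than `k + 1`. -/
theorem not_pathwidthLE_succ_of_three_legs {L : Type*} {G : SimpleGraph V} {H : SimpleGraph W}
    {k : ℕ} (hH : ¬ pathwidthLE H k) (leg : V → Option L) (lab : Fin 3 → L)
    (hlab : Function.Injective lab) (f : Fin 3 → H →g G) (hf : ∀ a, Function.Injective (f a))
    (hleg : ∀ a x, leg (f a x) = some (lab a))
    (hconn : ∀ a, (G.induce {v | leg v ≠ some (lab a)}).Preconnected) :
    ¬ pathwidthLE G (k + 1) := by
  classical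
  rintro ⟨t, X, hX, hc⟩
  have full : ∀ a, ∃ q, (X q).Nonempty ∧ ∀ v ∈ X q, leg v = some (lab a) := by
    intro a
    by_contra! h
    refine hH ⟨t, _, hX.preimage (f a) (hf a), fun q => ?_⟩
    by_contra! hq
    have him : ((X q).preimage (f a) (hf a).injOn).image (f a) = X q := by
      apply Finset.eq_of_subset_of_card_le
      · intro v; simp only [Finset.mem_image, Finset.mem_preimage]; rintro ⟨x, hx, rfl⟩; exact hx
      · rw [Finset.card_image_of_injective _ (hf a)]
        exact (hc q).trans hq
    have hne : (X q).Nonempty := by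
      rw [← him, Finset.image_nonempty, ← Finset.card_pos]; omega
    obtain ⟨v, hv, hv'⟩ := h q hne
    rw [← him] at hv
    obtain ⟨x, -, rfl⟩ := Finset.mem_image.mp hv
    exact hv' (hleg a x)
  choose q hne hq using full
  have separate : ∀ a b c : Fin 3, a ≠ b → c ≠ b → q a ≤ q b → q b ≤ q c → False := by
    intro a b c hab hcb h1 h2
    obtain ⟨u, hu⟩ := hne a
    obtain ⟨w, hw⟩ := hne c
    have hu' : leg u ≠ some (lab b) := by
      rw [hq a u hu]; simpa using hlab.ne hab
    have hw' : leg w ≠ some (lab b) := by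
      rw [hq c w hw]; simpa using hlab.ne hcb
    obtain ⟨s, hs⟩ := hX.exists_mem_of_preconnected
      (SimpleGraph.Embedding.induce {v | leg v ≠ some (lab b)}).toHom (hconn b)
      (u := ⟨u, hu'⟩) (w := ⟨w, hw'⟩) h1 h2 hu hw
    exact s.2 (hq b _ hs)
  have h01 := le_total (q 0) (q 1)
  have h02 := le_total (q 0) (q 2)
  have h12 := le_total (q 1) (q 2)
  have s012 := separate 0 1 2 (by decide) (by decide)
  have s210 := separate 2 1 0 (by decide) (by decide)
  have s021 := separate 0 2 1 (by decide) (by decide)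
  have s120 := separate 1 2 0 (by decide) (by decide)
  have s102 := separate 1 0 2 (by decide) (by decide)
  have s201 := separate 2 0 1 (by decide) (by decide)
  tauto

theorem not_pathwidthLE_zero_of_adj {G : SimpleGraph V} {u v : V} (h : G.Adj u v) :
    ¬ pathwidthLE G 0 := by
  rintro ⟨t, X, hX, hc⟩
  obtain ⟨i, hu, hv⟩ := hX.2.1 h
  exact h.ne (Finset.card_le_one.mp (hc i) u hu v hv)

section Psi

variable {i : ℕ} {m : ℝ} {l : ℕ}

/-- The `p`-th vertex on leg `j` of `Ψ_{i+1, m}`. -/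
noncomputable def psiLegVertex (j : Fin l) (p : Fin (sc m)) : Option (PsiC (i + 1) m l) :=
  some (Sum.inl (j, p))

theorem psiLegVertex_inj {j : Fin l} {p q : Fin (sc m)} :
    psiLegVertex (i := i) j p = psiLegVertex j q ↔ p = q := by
  refine ⟨fun h => ?_, fun h => by rw [h]⟩
  injection h with h
  injection h with h
  exact congrArg Prod.snd h

/-- The copy of `Ψ_{i, √m}` hanging at the end of leg `j` of `Ψ_{i+1, m}`. -/
noncomputable def psiSub (hm : 0 < sc m) (j : Fin l) :
    Option (PsiC i (Real.sqrt m) (sc (Real.sqrt m))) → Option (PsiC (i + 1) m l)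
  | none => psiLegVertex j ⟨sc m - 1, by omega⟩
  | some c => some (Sum.inr (j, c))

theorem psiSub_injective (hm : 0 < sc m) (j : Fin l) :
    Function.Injective (psiSub (i := i) hm j) := by
  rintro (_ | a) (_ | b) h
  · rfl
  · cases h
  · cases h
  · injection h with h
    injection h with h
    injection h with _ h
    rw [h]

theorem not_psiRel_none_right {x : Option (PsiC i m l)} : ¬ PsiRel i m l x none := by
  cases i with
  | zero => exact id
  | succ i => rcases x with _ | ⟨_ | _⟩ <;> exact id

theorem psiRel_psiSub (hm : 0 < sc m) (j : Fin l)
    {a b : Option (PsiC i (Real.sqrt m) (sc (Real.sqrt m)))} (h : PsiRel _ _ _ a b) :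
    PsiRel (i + 1) m l (psiSub hm j a) (psiSub hm j b) := by
  rcases b with _ | b
  · exact absurd h not_psiRel_none_right
  rcases a with _ | a
  · exact ⟨rfl, by simp only; omega, h⟩
  · exact ⟨rfl, h⟩

/-- The three kinds of edges of `Ψ_{i+1, m}`. -/
theorem psiRel_succ_cases (hm : 0 < sc m) {x y : Option (PsiC (i + 1) m l)}
    (h : PsiRel (i + 1) m l x y) :
    (∃ j, x = none ∧ y = some (Sum.inl (j, ⟨0, hm⟩))) ∨
    (∃ j p, ∃ hp : p + 1 < sc m, x = some (Sum.inl (j, ⟨p, by omega⟩)) ∧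
      y = some (Sum.inl (j, ⟨p + 1, hp⟩))) ∨
    (∃ j a b, x = psiSub hm j a ∧ y = psiSub hm j b ∧ PsiRel _ _ _ a b) := by
  rcases y with _ | ⟨⟨j', p', hp'⟩ | ⟨j', c'⟩⟩
  · exact absurd h not_psiRel_none_right
  · rcases x with _ | ⟨⟨j, p, hp⟩ | ⟨j, c⟩⟩
    · obtain rfl : p' = 0 := h
      exact Or.inl ⟨j', rfl, rfl⟩
    · obtain ⟨rfl, h⟩ : j = j' ∧ p + 1 = p' := h
      subst h
      exact Or.inr (Or.inl ⟨j, p, hp', rfl, rfl⟩)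
    · exact h.elim
  · rcases x with _ | ⟨⟨j, p, hp⟩ | ⟨j, c⟩⟩
    · exact h.elim
    · obtain ⟨rfl, h, h'⟩ : j = j' ∧ p + 1 = sc m ∧ PsiRel _ _ _ none (some c') := h
      obtain rfl : p = sc m - 1 := by omega
      exact Or.inr (Or.inr ⟨j, none, some c', rfl, rfl, h'⟩)
    · obtain ⟨rfl, h⟩ : j = j' ∧ PsiRel _ _ _ (some c) (some c') := h
      exact Or.inr (Or.inr ⟨j, some c, some c', rfl, rfl, h⟩)

/-- `psiSub` as a graph homomorphism. -/
noncomputable def psiSubHom (hm : 0 < sc m) (j : Fin l) :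
    PsiGraph i (Real.sqrt m) (sc (Real.sqrt m)) →g PsiGraph (i + 1) m l where
  toFun := psiSub hm j
  map_rel' := by
    rintro a b ⟨hne, h⟩
    exact ⟨(psiSub_injective hm j).ne hne, h.imp (psiRel_psiSub hm j) (psiRel_psiSub hm j)⟩

/-- The leg of `Ψ_{i+1, m}` containing a given vertex. -/
noncomputable def psiLeg : Option (PsiC (i + 1) m l) → Option (Fin l)
  | none => none
  | some (Sum.inl (j, _)) => some j
  | some (Sum.inr (j, _)) => some j

theorem psiLeg_psiSub (hm : 0 < sc m) (j : Fin l)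
    (a : Option (PsiC i (Real.sqrt m) (sc (Real.sqrt m)))) :
    psiLeg (psiSub hm j a) = some j := by
  cases a <;> rfl

theorem psiGraph_adj_root (hm : 0 < sc m) (j : Fin l) :
    (PsiGraph (i + 1) m l).Adj none (some (Sum.inl (j, ⟨0, hm⟩))) :=
  ⟨nofun, Or.inl rfl⟩

theorem psiGraph_adj_leg {p : ℕ} (hp : p + 1 < sc m) (j : Fin l) :
    (PsiGraph (i + 1) m l).Adj (some (Sum.inl (j, ⟨p, by omega⟩)))
      (some (Sum.inl (j, ⟨p + 1, hp⟩))) := by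
  refine ⟨fun h => ?_, Or.inl ⟨rfl, rfl⟩⟩
  have := Fin.val_eq_of_eq (psiLegVertex_inj.mp h)
  simp at this

theorem induce_psiLeg_reachable_inl (hm : 0 < sc m) {T : Set (Option (Fin l))} (hT : none ∈ T)
    {j : Fin l} (hj : some j ∈ T) : ∀ (p : ℕ) (hp : p < sc m),
      ((PsiGraph (i + 1) m l).induce {v | psiLeg v ∈ T}).Reachable
        ⟨none, hT⟩ ⟨some (Sum.inl (j, ⟨p, hp⟩)), hj⟩ := by
  intro p
  induction p with
  | zero => exact fun hp => SimpleGraph.Adj.reachable (psiGraph_adj_root hm j)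
  | succ p ih =>
    exact fun hp => (ih (by omega)).trans (SimpleGraph.Adj.reachable (psiGraph_adj_leg hp j))

/-- The union of the root and any set of legs is connected. -/
theorem induce_psiLeg_preconnected (hm : 0 < sc m) {T : Set (Option (Fin l))} (hT : none ∈ T)
    (hsub : (PsiGraph i (Real.sqrt m) (sc (Real.sqrt m))).Preconnected) :
    ((PsiGraph (i + 1) m l).induce {v | psiLeg v ∈ T}).Preconnected := by
  have key : ∀ v, ((PsiGraph (i + 1) m l).induce {v | psiLeg v ∈ T}).Reachable ⟨none, hT⟩ v := by
    rintro ⟨_ | ⟨⟨j, p⟩ | ⟨j, c⟩⟩, hv⟩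
    · rfl
    · exact induce_psiLeg_reachable_inl hm hT hv p p.2
    · have hj : some j ∈ T := hv
      let φ : PsiGraph i (Real.sqrt m) (sc (Real.sqrt m)) →g
          (PsiGraph (i + 1) m l).induce {v | psiLeg v ∈ T} :=
        { toFun := fun a => ⟨psiSub hm j a, by simpa [psiLeg_psiSub] using hj⟩
          map_rel' := fun h => (psiSubHom hm j).map_adj h }
      exact (induce_psiLeg_reachable_inl hm hT hj _ _).trans ((hsub none (some c)).map φ)
  exact fun u v => (key u).symm.trans (key v)

theorem sc_pos (hm : 0 < m) : 0 < sc m :=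
  Nat.ceil_pos.mpr (Real.sqrt_pos.mpr hm)

theorem psiGraph_preconnected (hm : 0 < m) : (PsiGraph i m l).Preconnected := by
  induction i generalizing m l with
  | zero =>
    rintro (_ | u) (_ | v)
    · rfl
    · exact v.elim
    · exact u.elim
    · exact u.elim
  | succ i ih =>
    intro u v
    exact (induce_psiLeg_preconnected (sc_pos hm) (Set.mem_univ none) (ih (Real.sqrt_pos.mpr hm))
      ⟨u, trivial⟩ ⟨v, trivial⟩).map (SimpleGraph.Embedding.induce _).toHom

theorem three_pow_le_sqrt {i : ℕ} {m : ℝ} (hm : (3 : ℝ) ^ (2 ^ (i + 1)) ≤ m) :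
    (3 : ℝ) ^ (2 ^ i) ≤ Real.sqrt m :=
  Real.le_sqrt_of_sq_le (by rwa [← pow_mul, ← pow_succ])

theorem three_le_sc (hm : (3 : ℝ) ^ (2 ^ (i + 1)) ≤ m) : 3 ≤ sc m := by
  have h1 : (3 : ℝ) ^ 1 ≤ 3 ^ (2 ^ i) := pow_le_pow_right₀ (by norm_num) Nat.one_le_two_pow
  have h2 := (h1.trans (three_pow_le_sqrt hm)).trans (Nat.le_ceil _)
  rw [pow_one] at h2
  exact_mod_cast h2

theorem not_pathwidthLE_psiGraph (hm : (3 : ℝ) ^ (2 ^ (i + 1)) ≤ m) (hl : 3 ≤ l) :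
    ¬ pathwidthLE (PsiGraph (i + 1) m l) (i + 1) := by
  have hsc := three_le_sc hm
  have hm0 : 0 < m := lt_of_lt_of_le (by positivity) hm
  have hconn : ∀ a : Fin 3, ((PsiGraph (i + 1) m l).induce
      {v | psiLeg v ≠ some (Fin.castLE hl a)}).Preconnected := fun a =>
    induce_psiLeg_preconnected (T := {x | x ≠ some (Fin.castLE hl a)}) (by omega) nofun
      (psiGraph_preconnected (Real.sqrt_pos.mpr hm0))
  induction i generalizing m l with
  | zero =>
    let g : Fin 3 → Bool → Option (PsiC (0 + 1) m l) := fun a b =>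
      some (Sum.inl (Fin.castLE hl a, cond b ⟨1, by omega⟩ ⟨0, by omega⟩))
    have hg : ∀ a, (PsiGraph (0 + 1) m l).Adj (g a false) (g a true) := fun a =>
      psiGraph_adj_leg (p := 0) (by omega) _
    refine not_pathwidthLE_succ_of_three_legs (H := (⊤ : SimpleGraph Bool))
      (not_pathwidthLE_zero_of_adj (u := false) (v := true) nofun) psiLeg
      (Fin.castLE hl) (Fin.castLE_injective hl)
      (fun a => ⟨g a, ?_⟩) (fun a => ?_) (fun a x => rfl) hconn
    · rintro (_ | _) (_ | _) h
      · exact absurd rfl h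
      · exact hg a
      · exact (hg a).symm
      · exact absurd rfl h
    · rintro (_ | _) (_ | _) h
      · rfl
      · exact absurd h (hg a).ne
      · exact absurd h (hg a).ne'
      · rfl
  | succ i ih =>
    have hm' := three_pow_le_sqrt hm
    exact not_pathwidthLE_succ_of_three_legs
      (ih hm' (three_le_sc hm') (three_le_sc hm') (Real.sqrt_pos.mpr hm0) fun a =>
        induce_psiLeg_preconnected (T := {x | x ≠ some (Fin.castLE _ a)})
          (by have := three_le_sc hm'; omega) nofun
          (psiGraph_preconnected (Real.sqrt_pos.mpr (Real.sqrt_pos.mpr hm0))))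
      psiLeg (Fin.castLE hl) (Fin.castLE_injective hl)
      (fun a => psiSubHom (sc_pos hm0) (Fin.castLE hl a))
      (fun a => psiSub_injective (sc_pos hm0) _) (fun a x => psiLeg_psiSub (sc_pos hm0) _ x) hconn

/-- The bags of a path decomposition of `Ψ_{i+1, m}` built leg by leg, given the bags `Y` of one of
`Ψ_{i, √m}`: first the edges of the leg, then `Y`, with the root added everywhere. -/
noncomputable def psiBag [DecidableEq (Option (PsiC (i + 1) m l))] {ι : Type} (hm : 0 < sc m)
    (Y : ι → Finset (Option (PsiC i (Real.sqrt m) (sc (Real.sqrt m))))) (j : Fin l) :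
    Fin (sc m) ⊕ ι → Finset (Option (PsiC (i + 1) m l))
  | Sum.inl q => {none, psiLegVertex j q, psiLegVertex j ⟨min (q + 1) (sc m - 1), by omega⟩}
  | Sum.inr x => insert none ((Y x).image (psiSub hm j))

section Bag

variable [DecidableEq (Option (PsiC (i + 1) m l))] {ι : Type} (hm : 0 < sc m)
  {Y : ι → Finset (Option (PsiC i (Real.sqrt m) (sc (Real.sqrt m))))} {j : Fin l}

theorem none_mem_psiBag {s : Fin (sc m) ⊕ ι} : none ∈ psiBag hm Y j s := by
  cases s <;> exact Finset.mem_insert_self _ _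

theorem mem_psiBag_inl {q : Fin (sc m)} {v : PsiC (i + 1) m l} :
    some v ∈ psiBag hm Y j (Sum.inl q) ↔ some v = psiLegVertex j q ∨
      some v = psiLegVertex j ⟨min (q + 1) (sc m - 1), by omega⟩ := by
  simp [psiBag]

theorem mem_psiBag_inr {x : ι} {v : PsiC (i + 1) m l} :
    some v ∈ psiBag hm Y j (Sum.inr x) ↔ ∃ a ∈ Y x, psiSub hm j a = some v := by
  simp [psiBag]

theorem psiLeg_of_mem_psiBag {s : Fin (sc m) ⊕ ι} {v : PsiC (i + 1) m l}
    (h : some v ∈ psiBag hm Y j s) : psiLeg (some v) = some j := by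
  cases s with
  | inl q => rcases (mem_psiBag_inl hm).mp h with h | h <;> rw [h] <;> rfl
  | inr x =>
    obtain ⟨a, -, h⟩ := (mem_psiBag_inr hm).mp h
    rw [← h, psiLeg_psiSub]

theorem psiLegVertex_mem_psiBag_inl {p q : Fin (sc m)} :
    psiLegVertex j p ∈ psiBag hm Y j (Sum.inl q) ↔
      (p : ℕ) = q ∨ (p : ℕ) = min ((q : ℕ) + 1) (sc m - 1) := by
  refine (mem_psiBag_inl hm).trans ?_
  rw [← Fin.ext_iff, ← Fin.ext_iff (b := ⟨_, by omega⟩)]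
  exact or_congr psiLegVertex_inj psiLegVertex_inj

theorem sub_notMem_psiBag_inl {q : Fin (sc m)} {c} :
    some (Sum.inr (j, c)) ∉ psiBag hm Y j (Sum.inl q) := by
  intro h
  rcases (mem_psiBag_inl hm).mp h with h | h <;> cases h

theorem psiSub_mem_psiBag_inr {x : ι} {a} :
    psiSub hm j a ∈ psiBag hm Y j (Sum.inr x) ↔ a ∈ Y x := by
  have : psiSub (l := l) hm j a ≠ none := by cases a <;> nofun
  simp [psiBag, this, (psiSub_injective hm j).eq_iff]

theorem psiLegVertex_mem_psiBag_inr (hY : ∀ x, none ∈ Y x) {x : ι} {p : Fin (sc m)} :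
    psiLegVertex j p ∈ psiBag hm Y j (Sum.inr x) ↔ (p : ℕ) = sc m - 1 := by
  constructor
  · intro h
    obtain ⟨_ | a, -, h⟩ := (mem_psiBag_inr hm).mp h
    · exact (Fin.val_eq_of_eq (psiLegVertex_inj.mp h)).symm
    · cases h
  · intro h
    have hp : p = ⟨sc m - 1, by omega⟩ := Fin.ext h
    rw [hp]
    exact (psiSub_mem_psiBag_inr hm (a := none)).mpr (hY x)

theorem card_psiBag_le {k : ℕ} (hk : 2 ≤ k) (hY : ∀ x, (Y x).card ≤ k) (s : Fin (sc m) ⊕ ι) :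
    (psiBag hm Y j s).card ≤ k + 1 := by
  cases s with
  | inl q => exact Finset.card_le_three.trans (by omega)
  | inr x =>
    exact (Finset.card_insert_le _ _).trans
      (Nat.succ_le_succ (Finset.card_image_le.trans (hY x)))

theorem psiBag_interval [LinearOrder ι] (hroot : ∀ x, none ∈ Y x)
    (hY : ∀ v (a b c : ι), a ≤ b → b ≤ c → v ∈ Y a → v ∈ Y c → v ∈ Y b)
    (v : Option (PsiC (i + 1) m l)) (a b c : Fin l ×ₗ (Fin (sc m) ⊕ₗ ι)) (hab : a ≤ b)
    (hbc : b ≤ c) (ha : v ∈ psiBag hm Y (ofLex a).1 (ofLex (ofLex a).2))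
    (hc : v ∈ psiBag hm Y (ofLex c).1 (ofLex (ofLex c).2)) :
    v ∈ psiBag hm Y (ofLex b).1 (ofLex (ofLex b).2) := by
  rcases v with _ | v
  · exact none_mem_psiBag hm
  have hac : (ofLex a).1 = (ofLex c).1 := Option.some.inj
    ((psiLeg_of_mem_psiBag hm ha).symm.trans (psiLeg_of_mem_psiBag hm hc))
  have hva := psiLeg_of_mem_psiBag hm ha
  rw [Prod.Lex.le_iff] at hab hbc
  obtain ⟨ja, a⟩ := a
  obtain ⟨jb, b⟩ := b
  obtain ⟨jc, c⟩ := c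
  change ja = jc at hac
  change ja < jb ∨ ja = jb ∧ a ≤ b at hab
  change jb < jc ∨ jb = jc ∧ b ≤ c at hbc
  change psiLeg (some v) = some ja at hva
  change some v ∈ psiBag hm Y ja (ofLex a) at ha
  change some v ∈ psiBag hm Y jc (ofLex c) at hc
  change some v ∈ psiBag hm Y jb (ofLex b)
  subst hac
  obtain ⟨rfl, hle⟩ : ja = jb ∧ a ≤ b := hab.resolve_left fun h => by
    rcases hbc with h' | h'
    · exact absurd h' h.not_gt
    · exact absurd h'.1 h.ne'
  replace hbc : b ≤ c := (hbc.resolve_left (lt_irrefl _)).2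
  induction a using Lex.rec with | _ a
  induction b using Lex.rec with | _ b
  induction c using Lex.rec with | _ c
  rw [ofLex_toLex] at ha hc ⊢
  rcases v with ⟨j, p⟩ | ⟨j, d⟩
  · obtain rfl : j = ja := Option.some.inj hva
    change psiLegVertex j p ∈ _ at ha hc
    change psiLegVertex j p ∈ _
    clear hva
    rcases a with a | a <;> rcases b with b | b <;> rcases c with c | c <;>
      simp only [Sum.Lex.inl_le_inl_iff, Sum.Lex.inr_le_inr_iff, Sum.Lex.not_inr_le_inl,
        psiLegVertex_mem_psiBag_inl, psiLegVertex_mem_psiBag_inr hm hroot,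
        Fin.le_def] at hle hbc ha hc ⊢ <;> omega
  · obtain rfl : j = ja := Option.some.inj hva
    rcases a with a | a
    · exact absurd ha (sub_notMem_psiBag_inl hm)
    rcases c with c | c
    · exact absurd hc (sub_notMem_psiBag_inl hm)
    rcases b with b | b
    · exact absurd hle Sum.Lex.not_inr_le_inl
    exact (psiSub_mem_psiBag_inr hm (a := some d)).mpr (hY _ a b c
      (Sum.Lex.inr_le_inr_iff.mp hle) (Sum.Lex.inr_le_inr_iff.mp hbc)
      ((psiSub_mem_psiBag_inr hm (a := some d)).mp ha)
      ((psiSub_mem_psiBag_inr hm (a := some d)).mp hc))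

end Bag

/-- `Ψ_{i, m}` has a path decomposition with at most `i + 2` vertices per bag and the root in
every bag. -/
theorem exists_psiGraph_decomp (hm : 0 < m) (hl : 0 < l) :
    ∃ (ι : Type) (_ : LinearOrder ι) (_ : Finite ι) (_ : Nonempty ι)
      (X : ι → Finset (Option (PsiC i m l))), (∀ x, none ∈ X x) ∧ (∀ v, ∃ x, v ∈ X x) ∧
      (∀ u v, PsiRel i m l u v → ∃ x, u ∈ X x ∧ v ∈ X x) ∧
      (∀ v (a b c : ι), a ≤ b → b ≤ c → v ∈ X a → v ∈ X c → v ∈ X b) ∧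
      ∀ x, (X x).card ≤ i + 2 := by
  induction i generalizing m l with
  | zero =>
    refine ⟨Unit, inferInstance, inferInstance, inferInstance, fun _ => {none}, by simp, ?_,
      fun _ _ h => h.elim, fun _ _ _ _ _ _ h _ => h, by simp⟩
    rintro (_ | v)
    · simp
    · exact v.elim
  | succ i ih =>
    obtain ⟨ι, _, _, ⟨x₀⟩, Y, hroot, hv, he, hi, hc⟩ :=
      ih (Real.sqrt_pos.mpr hm) (sc_pos (Real.sqrt_pos.mpr hm))
    classical
    have := Fintype.ofFinite ι
    have hs := sc_pos hm
    let idx : Fin l → Fin (sc m) ⊕ ι → Fin l ×ₗ (Fin (sc m) ⊕ₗ ι) := fun j s => toLex (j, toLex s)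
    refine ⟨Fin l ×ₗ (Fin (sc m) ⊕ₗ ι), inferInstance, inferInstance,
      ⟨idx ⟨0, hl⟩ (Sum.inr x₀)⟩,
      fun x => psiBag hs Y (ofLex x).1 (ofLex (ofLex x).2), fun x => none_mem_psiBag hs, ?_, ?_,
      psiBag_interval hs hroot hi, fun x => card_psiBag_le hs (by omega) hc _⟩
    · rintro (_ | ⟨⟨j, p⟩ | ⟨j, d⟩⟩)
      · exact ⟨idx ⟨0, hl⟩ (Sum.inr x₀), none_mem_psiBag hs⟩
      · exact ⟨idx j (Sum.inl p), (psiLegVertex_mem_psiBag_inl hs).mpr (Or.inl rfl)⟩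
      · obtain ⟨x, hx⟩ := hv (some d)
        exact ⟨idx j (Sum.inr x), (psiSub_mem_psiBag_inr hs (a := some d)).mpr hx⟩
    · intro u v h
      rcases psiRel_succ_cases hs h with
        ⟨j, rfl, rfl⟩ | ⟨j, p, hp, rfl, rfl⟩ | ⟨j, a, b, rfl, rfl, hab⟩
      · exact ⟨idx j (Sum.inl ⟨0, hs⟩), none_mem_psiBag hs,
          (psiLegVertex_mem_psiBag_inl hs).mpr (Or.inl rfl)⟩
      · exact ⟨idx j (Sum.inl ⟨p, by omega⟩), (psiLegVertex_mem_psiBag_inl hs).mpr (Or.inl rfl),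
          (psiLegVertex_mem_psiBag_inl hs).mpr (Or.inr (by simp only; omega))⟩
      · obtain ⟨x, ha, hb⟩ := he a b hab
        exact ⟨idx j (Sum.inr x), (psiSub_mem_psiBag_inr hs).mpr ha,
          (psiSub_mem_psiBag_inr hs).mpr hb⟩

theorem pathwidthLE_psiGraph (hm : 0 < m) (hl : 0 < l) : pathwidthLE (PsiGraph i m l) (i + 1) := by
  obtain ⟨ι, _, _, _, X, -, hv, he, hi, hc⟩ := exists_psiGraph_decomp (i := i) hm hl
  refine pathwidthLE_of_linearOrder X hv (fun u v h => ?_) hi hc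
  rcases h.2 with h | h
  · exact he u v h
  · obtain ⟨x, h1, h2⟩ := he v u h
    exact ⟨x, h2, h1⟩

end Psi

/-- **Lemma.** For each `i ≥ 1` and `m ≥ 3^(2^i)`, the tree `Ψ_{i,m}` has pathwidth exactly
`i + 1`. -/
theorem pathwidth_Psi (i : ℕ) (hi : 1 ≤ i) (m : ℝ) (hm : (3 : ℝ) ^ (2 ^ i) ≤ m) :
    pathwidth (PsiGraph i m (sc m)) = i + 1 := by
  have hm0 : 0 < m := lt_of_lt_of_le (by positivity) hm
  have hle := pathwidthLE_psiGraph (i := i) hm0 (sc_pos hm0)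
  refine le_antisymm (Nat.sInf_le hle) (le_csInf ⟨_, hle⟩ fun k hk => ?_)
  obtain ⟨i, rfl⟩ := Nat.exists_eq_add_of_le' hi
  by_contra! hlt
  exact not_pathwidthLE_psiGraph hm (three_le_sc hm) (hk.mono (by omega))
end

section
/- For every integer d ≥ 0, the full rooted ternary tree of depth d (the tree in which the root and every internal vertex has exactly three children and every leaf is at distance d from the root) has pathwidth exactly d. -/
open scoped BigOperators

/-- The full rooted ternary tree of depth `d`: vertices are words over `Fin 3` of length at
most `d` (the root is the empty word), and each vertex `x` of length `< d` is adjacent to its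
three children `a :: x`. -/
def TernaryTree (d : ℕ) : SimpleGraph {l : List (Fin 3) // l.length ≤ d} :=
  SimpleGraph.fromRel fun x y => ∃ a : Fin 3, (y : List (Fin 3)) = a :: (x : List (Fin 3))

theorem exists_suffix_mem_of_mem_uIcc {ι α : Type*} [LinearOrder ι] {d : ℕ}
    {A : List α → Set ι} (hconn : ∀ w, w.length ≤ d → (A w).OrdConnected)
    (hadj : ∀ a w, w.length < d → (A w ∩ A (a :: w)).Nonempty) {r j : ι} (hr : r ∈ A [])
    (w : List α) (hw : w.length ≤ d) {i : ι} (hi : i ∈ A w) (hj : j ∈ Set.uIcc i r) :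
    ∃ s, s <:+ w ∧ j ∈ A s := by
  induction w generalizing i with
  | nil => exact ⟨[], List.suffix_refl _, (hconn [] hw).uIcc_subset hi hr hj⟩
  | cons a w ih =>
    obtain ⟨p, hp, hpa⟩ := hadj a w hw
    rcases Set.uIcc_subset_uIcc_union_uIcc (b := p) hj with h | h
    · exact ⟨a :: w, List.suffix_refl _, (hconn _ hw).uIcc_subset hi hpa h⟩
    · obtain ⟨s, hs, hjs⟩ := ih (Nat.le_of_lt hw) hp h
      exact ⟨s, hs.trans (List.suffix_cons a w), hjs⟩

/-- Among three points of a linear order, one lies between the two others. -/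
theorem exists_middle_of_fin_three {ι : Type*} [LinearOrder ι] (f : Fin 3 → ι) :
    ∃ a b c, a ≠ b ∧ c ≠ b ∧ f b ∈ Set.uIcc (f a) (f c) := by
  simp only [Set.mem_uIcc]
  rcases le_total (f 0) (f 1) with h | h <;> rcases le_total (f 1) (f 2) with h' | h' <;>
    rcases le_total (f 0) (f 2) with h'' | h''
  · exact ⟨0, 1, 2, by decide, by decide, by tauto⟩
  · exact ⟨0, 1, 2, by decide, by decide, by tauto⟩
  · exact ⟨0, 2, 1, by decide, by decide, by tauto⟩
  · exact ⟨1, 0, 2, by decide, by decide, by tauto⟩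
  · exact ⟨1, 0, 2, by decide, by decide, by tauto⟩
  · exact ⟨0, 2, 1, by decide, by decide, by tauto⟩
  · exact ⟨0, 1, 2, by decide, by decide, by tauto⟩
  · exact ⟨0, 1, 2, by decide, by decide, by tauto⟩

/-- If order-connected sets indexed by the vertices of the ternary tree of depth `d` meet along
every edge, then some point lies in at least `d + 1` of them. -/
theorem exists_mem_of_card_eq_succ_depth {ι : Type*} [LinearOrder ι] (d : ℕ)
    (A : List (Fin 3) → Set ι) (hne : ∀ w, w.length ≤ d → (A w).Nonempty)
    (hconn : ∀ w, w.length ≤ d → (A w).OrdConnected)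
    (hadj : ∀ a w, w.length < d → (A w ∩ A (a :: w)).Nonempty) :
    ∃ (i : ι) (S : Finset (List (Fin 3))),
      (∀ w ∈ S, w.length ≤ d ∧ i ∈ A w) ∧ S.card = d + 1 := by
  induction d generalizing A with
  | zero =>
    obtain ⟨i, hi⟩ := hne [] le_rfl
    exact ⟨i, {[]}, by simpa using hi, by simp⟩
  | succ d ih =>
    have key (a : Fin 3) := ih (fun w => A (w ++ [a]))
      (fun w hw => hne _ (by simpa using hw)) (fun w hw => hconn _ (by simpa using hw))
      (fun b w hw => hadj b (w ++ [a]) (by simpa using hw))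
    choose f S hS hcard using key
    obtain ⟨r, hr⟩ := hne [] (Nat.zero_le _)
    obtain ⟨a, b, c, hab, hcb, hmid⟩ := exists_middle_of_fin_three f
    have hsuffix (x : Fin 3) (hx : f b ∈ Set.uIcc (f x) r) :
        ∃ w s : List (Fin 3), s <:+ w ++ [x] ∧ s.length ≤ d + 1 ∧ f b ∈ A s := by
      obtain ⟨w, hw⟩ : (S x).Nonempty := Finset.card_pos.1 (by rw [hcard]; omega)
      have hlen : (w ++ [x]).length ≤ d + 1 := by simpa using (hS x w hw).1
      obtain ⟨s, hs, hjs⟩ :=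
        exists_suffix_mem_of_mem_uIcc hconn hadj hr _ hlen (hS x w hw).2 hx
      exact ⟨w, s, hs, hs.length_le.trans hlen, hjs⟩
    obtain ⟨x, hxb, hx⟩ : ∃ x, x ≠ b ∧ f b ∈ Set.uIcc (f x) r := by
      rcases Set.uIcc_subset_uIcc_union_uIcc (b := r) hmid with h | h
      · exact ⟨a, hab, h⟩
      · exact ⟨c, hcb, Set.uIcc_comm r (f c) ▸ h⟩
    obtain ⟨w, s, ⟨t, ht⟩, hslen, hs⟩ := hsuffix x hx
    refine ⟨f b, insert s ((S b).image (· ++ [b])), ?_, ?_⟩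
    · intro v hv
      rcases Finset.mem_insert.1 hv with rfl | hv
      · exact ⟨hslen, hs⟩
      · obtain ⟨u, hu, rfl⟩ := Finset.mem_image.1 hv
        exact ⟨by simpa using (hS b u hu).1, (hS b u hu).2⟩
    · rw [Finset.card_insert_of_notMem, Finset.card_image_of_injective _
        (List.append_left_injective [b]), hcard]
      intro hmem
      obtain ⟨u, -, rfl⟩ := Finset.mem_image.1 hmem
      have := congrArg List.getLast? ht
      simp only [← List.append_assoc, List.getLast?_concat, Option.some.injEq] at this
      exact hxb this.symm

theorem TernaryTree.adj_cons {d : ℕ} (a : Fin 3) (w : List (Fin 3)) (hw : w.length ≤ d)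
    (haw : (a :: w).length ≤ d) : (TernaryTree d).Adj ⟨w, hw⟩ ⟨a :: w, haw⟩ := by
  rw [TernaryTree, SimpleGraph.fromRel_adj]
  exact ⟨by simp, Or.inl ⟨a, rfl⟩⟩

theorem le_of_pathwidthLE_ternaryTree {d k : ℕ} (h : pathwidthLE (TernaryTree d) k) : d ≤ k := by
  obtain ⟨t, X, ⟨hcover, hedge, hint⟩, hcard⟩ := h
  obtain ⟨i, S, hS, hSc⟩ := exists_mem_of_card_eq_succ_depth d
    (fun w => {i : Fin t | ∃ h : w.length ≤ d, ⟨w, h⟩ ∈ X i})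
    (fun w hw => (hcover ⟨w, hw⟩).imp fun i hi => ⟨hw, hi⟩)
    (fun w hw => ⟨fun i ⟨_, hi⟩ l ⟨_, hl⟩ j hj => ⟨hw, hint _ i j l hj.1 hj.2 hi hl⟩⟩)
    (fun a w hw => (hedge (TernaryTree.adj_cons a w hw.le hw)).imp
      fun i hi => ⟨⟨hw.le, hi.1⟩, ⟨hw, hi.2⟩⟩)
  have hsub : S ⊆ (X i).image Subtype.val := fun w hw => by
    obtain ⟨-, hlen, hmem⟩ := hS w hw
    exact Finset.mem_image.2 ⟨_, hmem, rfl⟩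
  have := (Finset.card_le_card hsub).trans (Finset.card_image_le.trans (hcard i))
  omega

/-- The number whose base-three digits, least significant first, are the letters of `w`. -/
def ternaryValue (w : List (Fin 3)) : ℕ := Nat.ofDigits 3 (w.map Fin.val)

theorem ternaryValue_cons (a : Fin 3) (w : List (Fin 3)) :
    ternaryValue (a :: w) = a + 3 * ternaryValue w := by
  simp [ternaryValue, Nat.ofDigits_cons]

theorem ternaryValue_cons_div (a : Fin 3) (w : List (Fin 3)) :
    ternaryValue (a :: w) / 3 = ternaryValue w := by
  rw [ternaryValue_cons]
  omega

theorem ternaryValue_lt (w : List (Fin 3)) : ternaryValue w < 3 ^ w.length := by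
  induction w with
  | nil => simp [ternaryValue]
  | cons a w ih =>
    rw [ternaryValue_cons, List.length_cons, pow_succ]
    omega

theorem eq_of_ternaryValue_eq {v w : List (Fin 3)} (hlen : v.length = w.length)
    (h : ternaryValue v = ternaryValue w) : v = w := by
  induction v generalizing w with
  | nil => exact (List.length_eq_zero_iff.1 hlen.symm).symm
  | cons a v ih =>
    cases w with
    | nil => simp at hlen
    | cons b w =>
      rw [ternaryValue_cons, ternaryValue_cons] at h
      rw [ih (w := w) (by simpa using hlen) (by omega), Fin.ext (a := a) (b := b) (by omega)]

/-- The bags are the root-to-leaf paths, in the lexicographic order of the leaves. -/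
theorem pathwidthLE_ternaryTree (d : ℕ) : pathwidthLE (TernaryTree d) d := by
  classical
  have : Fintype {l : List (Fin 3) // l.length ≤ d} := (List.finite_length_le (Fin 3) d).fintype
  let X (i : Fin (3 ^ d)) : Finset {l : List (Fin 3) // l.length ≤ d} :=
    Finset.univ.filter fun v => i / 3 ^ (d - v.1.length) = ternaryValue v.1
  have hX (i v) : v ∈ X i ↔ i / 3 ^ (d - v.1.length) = ternaryValue v.1 := by simp [X]
  have hcover (v : {l : List (Fin 3) // l.length ≤ d}) : ∃ i, v ∈ X i := by
    refine ⟨⟨ternaryValue v.1 * 3 ^ (d - v.1.length), ?_⟩, ?_⟩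
    · calc ternaryValue v.1 * 3 ^ (d - v.1.length)
          < 3 ^ v.1.length * 3 ^ (d - v.1.length) := by
            gcongr
            exact ternaryValue_lt v.1
        _ = 3 ^ d := by rw [← pow_add, Nat.add_sub_cancel' v.2]
    · rw [hX]
      exact Nat.mul_div_cancel _ (by positivity)
  have hparent {u v : {l : List (Fin 3) // l.length ≤ d}} {a : Fin 3} (h : v.1 = a :: u.1)
      {i} (hv : v ∈ X i) : u ∈ X i := by
    have hlen : d - u.1.length = d - v.1.length + 1 := by
      have := v.2
      simp only [h, List.length_cons] at this ⊢
      omega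
    rw [hX] at hv ⊢
    rw [hlen, pow_succ, ← Nat.div_div_eq_div_mul, hv, h, ternaryValue_cons_div]
  refine ⟨3 ^ d, X, ⟨hcover, fun u v huv => ?_, fun v i j l hij hjl hi hl => ?_⟩, fun i => ?_⟩
  · rw [TernaryTree, SimpleGraph.fromRel_adj] at huv
    rcases huv.2 with ⟨a, h⟩ | ⟨a, h⟩
    · exact (hcover v).imp fun i hi => ⟨hparent h hi, hi⟩
    · exact (hcover u).imp fun i hi => ⟨hi, hparent h hi⟩
  · rw [hX] at hi hl ⊢
    exact le_antisymm ((Nat.div_le_div_right hjl).trans hl.le)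
      (hi.ge.trans (Nat.div_le_div_right hij))
  · rw [← Finset.card_range (d + 1)]
    refine Finset.card_le_card_of_injOn (fun v => v.1.length)
      (fun v _ => by simpa [Nat.lt_succ_iff] using v.2) fun u hu v hv huv => ?_
    have hu := (hX i u).1 hu
    have hv := (hX i v).1 hv
    simp only at huv
    exact Subtype.ext (eq_of_ternaryValue_eq huv (by rw [← hu, ← hv, huv]))

/-- **Lemma.** For every `d ≥ 0`, the full rooted ternary tree of depth `d` has pathwidth
exactly `d`. -/
theorem pathwidth_ternaryTree (d : ℕ) : pathwidth (TernaryTree d) = d := by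
  exact le_antisymm (Nat.sInf_le (pathwidthLE_ternaryTree d))
    (le_csInf ⟨d, pathwidthLE_ternaryTree d⟩ fun _ => le_of_pathwidthLE_ternaryTree)
end

section
/- Let S be an unweighted tree with a vertex r ∈ V(S) and let L ≥ 0. Let S_1,…,S_ℓ be vertex-disjoint subtrees of S such that for each i ∈ [ℓ], S_i is attached to r via a path Q_i of length at least L, and for i ≠ j the paths Q_i and Q_j intersect only at r. Let g : V(S) → V(T) be a non-contractive embedding of S into a metric tree T, and let P be a simple path in T. If I = {i ∈ [ℓ] : d_T(g(S_i), P) < L/2}, then Σ_{{u,v} ∈ E(S)} d_T(g(u), g(v)) ≥ |I|² · L / 16. -/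
open scoped BigOperators

open scoped Classical in
/-- Sum of (a symmetric function) `f` over the edges of `G`: each unordered edge is counted
once. -/
noncomputable def edgeSum {V : Type*} [Fintype V] (G : SimpleGraph V) (f : V → V → ℝ) : ℝ :=
  (∑ u, ∑ v, if G.Adj u v then f u v else 0) / 2

open scoped Classical in
/-- The number of edges of `G`, as a real number. -/
noncomputable def numEdges {V : Type*} [Fintype V] (G : SimpleGraph V) : ℝ :=
  (∑ u, ∑ v, if G.Adj u v then (1 : ℝ) else 0) / 2

namespace SimpleGraph

variable {V W : Type*}

lemma IsTree.isPath_unique {G : SimpleGraph V} (hG : G.IsTree) {u v : V} {p q : G.Walk u v}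
    (hp : p.IsPath) (hq : q.IsPath) : p = q :=
  congrArg Subtype.val ((hG.isAcyclic.subsingleton_path u v).elim ⟨p, hp⟩ ⟨q, hq⟩)

section ShortestPath

variable {G : SimpleGraph V} {len : Sym2 V → ℝ}

lemma spDist_le (hlen : ∀ e, 0 ≤ len e) {u v : V} (w : G.Walk u v) :
    spDist G len u v ≤ (w.edges.map len).sum := by
  refine csInf_le ⟨0, ?_⟩ ⟨w, rfl⟩
  rintro _ ⟨w, rfl⟩
  exact List.sum_nonneg fun t ht => by
    obtain ⟨e, -, rfl⟩ := List.mem_map.1 ht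
    exact hlen e

lemma spDist_nonneg (hlen : ∀ e, 0 ≤ len e) (u v : V) : 0 ≤ spDist G len u v := by
  refine Real.sInf_nonneg ?_
  rintro _ ⟨w, rfl⟩
  exact List.sum_nonneg fun t ht => by
    obtain ⟨e, -, rfl⟩ := List.mem_map.1 ht
    exact hlen e

lemma spDist_self (hlen : ∀ e, 0 ≤ len e) (u : V) : spDist G len u u = 0 :=
  le_antisymm (by simpa using spDist_le hlen (Walk.nil : G.Walk u u)) (spDist_nonneg hlen u u)

/-- In a tree, the shortest-path distance is the length of any simple path. -/
lemma IsTree.spDist_eq (hG : G.IsTree) (hlen : ∀ e, 0 ≤ len e) {u v : V} {p : G.Walk u v}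
    (hp : p.IsPath) : spDist G len u v = (p.edges.map len).sum := by
  classical
  refine le_antisymm (spDist_le hlen p) (le_csInf ⟨_, p, rfl⟩ ?_)
  rintro _ ⟨w, rfl⟩
  rw [hG.isPath_unique hp w.bypass_isPath]
  refine (w.edges_bypass_sublist_edges.map len).sum_le_sum fun t ht => ?_
  obtain ⟨e, -, rfl⟩ := List.mem_map.1 ht
  exact hlen e

lemma IsTree.spDist_comm (hG : G.IsTree) (hlen : ∀ e, 0 ≤ len e) (u v : V) :
    spDist G len u v = spDist G len v u := by
  obtain ⟨p, hp, -⟩ := hG.connected.exists_path_of_dist u v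
  rw [hG.spDist_eq hlen hp, hG.spDist_eq hlen hp.reverse]
  simp

lemma IsTree.spDist_triangle (hG : G.IsTree) (hlen : ∀ e, 0 ≤ len e) (u v w : V) :
    spDist G len u w ≤ spDist G len u v + spDist G len v w := by
  obtain ⟨p, hp, -⟩ := hG.connected.exists_path_of_dist u v
  obtain ⟨q, hq, -⟩ := hG.connected.exists_path_of_dist v w
  rw [hG.spDist_eq hlen hp, hG.spDist_eq hlen hq]
  simpa using spDist_le hlen (p.append q)

/-- Distances between vertices of a simple path are recovered from the distances to its
starting point. -/
lemma IsTree.spDist_le_abs_sub (hG : G.IsTree) (hlen : ∀ e, 0 ≤ len e) {x y : V}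
    {p : G.Walk x y} (hp : p.IsPath) {q q' : V} (hq : q ∈ p.support) (hq' : q' ∈ p.support) :
    spDist G len q q' ≤ |spDist G len x q - spDist G len x q'| := by
  classical
  have key : ∀ {a b : V} (hb : b ∈ p.support), a ∈ (p.takeUntil b hb).support →
      spDist G len a b ≤ spDist G len x b - spDist G len x a := by
    intro a b hb ha
    rw [hG.spDist_eq hlen (hp.takeUntil hb), ← Walk.take_spec _ ha, Walk.edges_append,
      List.map_append, List.sum_append]
    have h₁ := spDist_le hlen ((p.takeUntil b hb).takeUntil a ha)
    have h₂ := spDist_le hlen ((p.takeUntil b hb).dropUntil a ha)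
    linarith
  by_cases h : q ∈ (p.takeUntil q' hq').support
  · rw [abs_sub_comm]
    exact (key hq' h).trans (le_abs_self _)
  · have h' : q' ∈ (p.takeUntil q hq).support := by
      rcases List.prefix_or_prefix_of_prefix (p.support_takeUntil_prefix_support hq)
        (p.support_takeUntil_prefix_support hq') with h' | h'
      · exact absurd (h'.subset (Walk.end_mem_support _)) h
      · exact h'.subset (Walk.end_mem_support _)
    rw [hG.spDist_comm hlen]
    exact (key hq h').trans (le_abs_self _)

end ShortestPath

lemma Walk.IsPath.append {G : SimpleGraph V} {u v w : V} {p : G.Walk u v} {q : G.Walk v w}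
    (hp : p.IsPath) (hq : q.IsPath) (h : ∀ z, z ∈ p.support → z ∈ q.support → z = v) :
    (p.append q).IsPath := by
  rw [Walk.isPath_def, Walk.support_append]
  have hq' := hq.support_nodup
  rw [← Walk.cons_tail_support, List.nodup_cons] at hq'
  refine List.nodup_append'.2 ⟨hp.support_nodup, hq'.2, fun z hz hz' => ?_⟩
  exact hq'.1 (h z hz (List.mem_of_mem_tail hz') ▸ hz')

lemma IsTree.dist_eq_length {G : SimpleGraph V} (hG : G.IsTree) {u v : V} {p : G.Walk u v}
    (hp : p.IsPath) : G.dist u v = p.length := by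
  obtain ⟨q, hq, h⟩ := hG.connected.exists_path_of_dist u v
  rw [← h, hG.isPath_unique hp hq]

/-- A path attached to a connected vertex set extends to a path to any vertex of that set. -/
lemma exists_isPath_extending {G : SimpleGraph V} {A : Set V} (hA : (G.induce A).Connected)
    {r b v : V} (hb : b ∈ A) (hv : v ∈ A) {q : G.Walk r b} (hq : q.IsPath)
    (hqA : ∀ z ∈ q.support, z ∈ A → z = b) :
    ∃ p : G.Walk r v, p.IsPath ∧ q.support ⊆ p.support ∧ q.length ≤ p.length ∧
      ∀ z ∈ p.support, z ∈ q.support ∨ z ∈ A := by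
  obtain ⟨s, hs, -⟩ := hA.exists_path_of_dist ⟨b, hb⟩ ⟨v, hv⟩
  let s' : G.Walk b v := s.map (Embedding.induce A).toHom
  have hs' : s'.IsPath := hs.map (Embedding.induce (G := G) A).injective
  have hsA : ∀ z ∈ s'.support, z ∈ A := by
    intro z hz
    obtain ⟨a, -, rfl⟩ := List.mem_map.1 (Walk.support_map _ s ▸ hz)
    exact a.2
  refine ⟨q.append s', hq.append hs' fun z hz hz' => hqA z hz (hsA z hz'), ?_, ?_, ?_⟩
  · exact fun z hz => (Walk.mem_support_append_iff _ _).2 (Or.inl hz)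
  · simp
  · intro z hz
    exact ((Walk.mem_support_append_iff _ _).1 hz).imp_right (hsA z)

open scoped Classical in
lemma Walk.IsPath.two_mul_le_sum_edges [Fintype V] {G : SimpleGraph V} {F : V → V → ℝ}
    (hF0 : ∀ u, F u u = 0) (hFs : ∀ u v, F u v = F v u)
    (hFt : ∀ u v w, F u w ≤ F u v + F v w) {u v : V} {p : G.Walk u v} (hp : p.IsPath) :
    2 * F u v ≤ ∑ a, ∑ b, if s(a, b) ∈ p.edges then F a b else 0 := by
  induction p with
  | nil => simp [hF0]
  | @cons u w v h p ih =>
    have hnot : s(u, w) ∉ p.edges := by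
      have := hp.isTrail.edges_nodup
      rw [Walk.edges_cons, List.nodup_cons] at this
      exact this.1
    have hsplit : ∀ a b : V, (if s(a, b) ∈ (Walk.cons h p).edges then F a b else 0) =
        (if a = u then if b = w then F a b else 0 else 0) +
        (if a = w then if b = u then F a b else 0 else 0) +
        (if s(a, b) ∈ p.edges then F a b else 0) := by
      intro a b
      have hne := h.ne
      by_cases h₁ : a = u ∧ b = w
      · obtain ⟨rfl, rfl⟩ := h₁
        simp [hnot, hne]
      by_cases h₂ : a = w ∧ b = u
      · obtain ⟨rfl, rfl⟩ := h₂
        simp [Sym2.eq_swap (a := a) (b := b), hnot, hne]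
      · have : s(a, b) ≠ s(u, w) := by simp; tauto
        grind [Walk.edges_cons]
    simp_rw [hsplit, Finset.sum_add_distrib]
    have := ih hp.of_cons
    have := hFt u w v
    simp only [Finset.sum_ite_irrel, Finset.sum_const_zero, Finset.sum_ite_eq', Finset.mem_univ,
      if_true]
    linarith [hFs u w]

open scoped Classical in
/-- Edge-disjoint paths: the sum of the distances between their ends is at most the edge sum. -/
lemma sum_le_edgeSum_of_isPath [Fintype V] {ι : Type*} {G : SimpleGraph V} {F : V → V → ℝ}
    (hF : ∀ u v, 0 ≤ F u v) (hF0 : ∀ u, F u u = 0) (hFs : ∀ u v, F u v = F v u)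
    (hFt : ∀ u v w, F u w ≤ F u v + F v w) (I : Finset ι) {r : V} {a : ι → V}
    (p : ∀ i, G.Walk r (a i)) (hp : ∀ i ∈ I, (p i).IsPath)
    (hpp : ∀ i ∈ I, ∀ j ∈ I, i ≠ j → ∀ e, e ∈ (p i).edges → e ∉ (p j).edges) :
    ∑ i ∈ I, F r (a i) ≤ edgeSum G F := by
  rw [edgeSum, le_div_iff₀ two_pos, Finset.sum_mul]
  calc ∑ i ∈ I, F r (a i) * 2
      ≤ ∑ i ∈ I, ∑ u, ∑ v, (if s(u, v) ∈ (p i).edges then F u v else 0) :=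
        Finset.sum_le_sum fun i hi => by
          rw [mul_comm]
          exact (hp i hi).two_mul_le_sum_edges hF0 hFs hFt
    _ = ∑ u, ∑ v, ∑ i ∈ I, (if s(u, v) ∈ (p i).edges then F u v else 0) := by
        rw [Finset.sum_comm]
        exact Finset.sum_congr rfl fun u _ => Finset.sum_comm
    _ ≤ _ := Finset.sum_le_sum fun u _ => Finset.sum_le_sum fun v _ => ?_
  by_cases h : ∃ i ∈ I, s(u, v) ∈ (p i).edges
  · obtain ⟨i, hi, hiu⟩ := h
    rw [Finset.sum_eq_single i, if_pos hiu, if_pos ((p i).adj_of_mem_edges hiu)]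
    · exact fun j hj hji => if_neg (hpp i hi j hj hji.symm _ hiu)
    · exact fun h => absurd hi h
  · push Not at h
    rw [Finset.sum_eq_zero fun i hi => if_neg (h i hi)]
    split_ifs
    exacts [hF u v, le_rfl]

end SimpleGraph

/-- The sum of the absolute values of `k` distinct integers is at least `k (k - 1) / 4`. -/
lemma Finset.card_mul_le_sum_abs (s : Finset ℤ) :
    (s.card : ℤ) * (s.card - 1) ≤ 4 * ∑ n ∈ s, |n| := by
  induction h : s.card generalizing s with
  | zero => simpa using Finset.sum_nonneg fun n _ => abs_nonneg n
  | succ k ih =>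
    obtain ⟨m, hm, hmax⟩ := s.exists_max_image (fun n => |n|) (Finset.card_pos.1 (by omega))
    have hsub : s ⊆ Finset.Icc (-|m|) |m| := fun n hn =>
      Finset.mem_Icc.2 (abs_le.1 (hmax n hn))
    have hcard := Finset.card_le_card hsub
    rw [Int.card_Icc] at hcard
    have h₀ := abs_nonneg m
    have h₁ : (k : ℤ) ≤ 2 * |m| := by omega
    have h₂ := ih (s.erase m) (by rw [Finset.card_erase_of_mem hm, h]; rfl)
    have h₃ := Finset.add_sum_erase s (fun n => |n|) hm
    push_cast
    linarith

lemma Finset.card_sq_mul_le_sum {ι : Type*} (I : Finset ι) {L c : ℝ} (hL : 0 < L) {f x : ι → ℝ}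
    (hf : ∀ i ∈ I, ∀ j ∈ I, i ≠ j → L ≤ |f i - f j|)
    (hx : ∀ i ∈ I, L ≤ x i) (hxf : ∀ i ∈ I, |f i - c| - L / 2 ≤ x i) :
    (I.card : ℝ) ^ 2 * L / 16 ≤ ∑ i ∈ I, x i := by
  classical
  set n : ι → ℤ := fun i => ⌊(f i - c) / L⌋ with hn
  have hinj : Set.InjOn n I := by
    intro i hi j hj hij
    by_contra hne
    have h := Int.abs_sub_lt_one_of_floor_eq_floor hij
    rw [← sub_div, abs_div, abs_of_pos hL, div_lt_one hL] at h
    have := hf i hi j hj hne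
    rw [sub_sub_sub_cancel_right] at h
    linarith
  have hsum := Finset.card_mul_le_sum_abs (I.image n)
  rw [Finset.card_image_of_injOn hinj, Finset.sum_image hinj] at hsum
  have hsum' : (I.card : ℝ) * (I.card - 1) ≤ 4 * ∑ i ∈ I, |(n i : ℝ)| := by exact_mod_cast hsum
  have h₁ : I.card * L ≤ ∑ i ∈ I, x i := by
    simpa using Finset.card_nsmul_le_sum I x L hx
  have h₂ : L * (∑ i ∈ I, |(n i : ℝ)|) - I.card * (3 / 2 * L) ≤ ∑ i ∈ I, x i := by
    rw [Finset.mul_sum, ← nsmul_eq_mul, ← Finset.sum_const, ← Finset.sum_sub_distrib]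
    refine Finset.sum_le_sum fun i hi => le_trans ?_ (hxf i hi)
    have hfr : |(n i : ℝ)| ≤ |(f i - c) / L| + 1 := by
      have h₁ := Int.floor_le ((f i - c) / L)
      have h₂ := Int.lt_floor_add_one ((f i - c) / L)
      rw [abs_le]
      constructor <;> linarith [neg_abs_le ((f i - c) / L), le_abs_self ((f i - c) / L)]
    rw [abs_div, abs_of_pos hL] at hfr
    have := mul_le_mul_of_nonneg_left hfr hL.le
    rw [mul_add, mul_div_cancel₀ _ hL.ne'] at this
    linarith
  have h₃ := mul_le_mul_of_nonneg_left hsum' hL.le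
  have hk : (0 : ℝ) ≤ I.card := Nat.cast_nonneg _
  rcases le_total (I.card : ℝ) 16 with h | h
  · nlinarith [mul_nonneg (mul_nonneg hk hL.le) (sub_nonneg.2 h)]
  · nlinarith [mul_nonneg (mul_nonneg hk hL.le) (sub_nonneg.2 h)]

/-- **Lemma.** Let `S` be an unweighted tree with `r ∈ V(S)`, let `L ≥ 0`, and let
`S_1, …, S_ℓ` (with vertex sets `A i`, inducing connected subgraphs) be vertex-disjoint
subtrees of `S` such that `S_i` is attached to `r` via a (simple) path `Q i` of length at
least `L` meeting `S_i` only in its endpoint `b i`, and for `i ≠ j` the paths `Q i` and `Q j`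
intersect only at `r`.  Let `g` be a non-contractive embedding of `S` into a metric tree `T`,
let `P` be a simple path in `T`, and let `I = {i : d_T(g(S_i), P) < L/2}`.  Then
`Σ_{{u,v} ∈ E(S)} d_T(g u, g v) ≥ |I|² · L / 16`. -/
theorem close_to_path_lower_bound {V W : Type} [Fintype V] [Fintype W]
    (S : SimpleGraph V) (hS : S.IsTree) (r : V) (L : ℝ) (hL : 0 ≤ L)
    (ℓ : ℕ) (A : Fin ℓ → Set V) (b : Fin ℓ → V)
    (hb : ∀ i, b i ∈ A i)
    (hconn : ∀ i, (S.induce (A i)).Connected)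
    (hdisj : ∀ i j, i ≠ j → Disjoint (A i) (A j))
    (Q : ∀ i, S.Walk r (b i))
    (hQpath : ∀ i, (Q i).IsPath)
    (hQlen : ∀ i, L ≤ ((Q i).length : ℝ))
    (hQA : ∀ i, ∀ v ∈ (Q i).support, v ∈ A i → v = b i)
    (hQQ : ∀ i j, i ≠ j → ∀ v, v ∈ (Q i).support → v ∈ (Q j).support → v = r)
    (T : SimpleGraph W) (hT : T.IsTree)
    (len : Sym2 W → ℝ) (hlen : ∀ e, 0 ≤ len e)
    (g : V → W)
    (hg : ∀ u v : V, (S.dist u v : ℝ) ≤ spDist T len (g u) (g v))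
    (x y : W) (P : T.Walk x y) (hP : P.IsPath)
    (I : Finset (Fin ℓ))
    (hI : ∀ i, i ∈ I ↔
      sInf {t : ℝ | ∃ a ∈ A i, ∃ q ∈ P.support, t = spDist T len (g a) q} < L / 2) :
    (I.card : ℝ) ^ 2 * L / 16 ≤ edgeSum S (fun u v => spDist T len (g u) (g v)) := by
  rcases hL.eq_or_lt with rfl | hL
  · simp only [mul_zero, zero_div, edgeSum]
    refine div_nonneg (Finset.sum_nonneg fun u _ => Finset.sum_nonneg fun v _ => ?_) two_pos.le
    split_ifs
    exacts [SimpleGraph.spDist_nonneg hlen _ _, le_rfl]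
  have hclose : ∀ i, ∃ a ∈ A i, i ∈ I → ∃ q ∈ P.support, spDist T len (g a) q < L / 2 := by
    intro i
    by_cases hi : i ∈ I
    · obtain ⟨_, ⟨a, ha, q, hq, rfl⟩, hlt⟩ := exists_lt_of_csInf_lt
        (by exact ⟨_, b i, hb i, x, P.start_mem_support, rfl⟩) ((hI i).1 hi)
      exact ⟨a, ha, fun _ => ⟨q, hq, hlt⟩⟩
    · exact ⟨b i, hb i, fun h => absurd h hi⟩
  choose a ha hclose using hclose
  have : Nonempty W := ⟨x⟩
  choose! q hqP hq using hclose
  have hbr : ∀ i, b i ≠ r := by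
    intro i hi
    have h : (Q i).length = 0 := by
      rw [← hS.dist_eq_length (hQpath i), hi, SimpleGraph.dist_self]
    have := hQlen i
    rw [h, Nat.cast_zero] at this
    linarith
  have hAQ : ∀ i j, i ≠ j → ∀ v ∈ A i, v ∉ (Q j).support := by
    classical
    intro i j hij v hv hvj
    obtain ⟨p, hp, hsub, -⟩ :=
      SimpleGraph.exists_isPath_extending (hconn i) (hb i) hv (hQpath i) (hQA i)
    have hbp := hsub (Q i).end_mem_support
    rw [hS.isPath_unique hp ((hQpath j).takeUntil hvj)] at hbp
    exact hbr i (hQQ i j hij _ (Q i).end_mem_support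
      ((Q j).support_takeUntil_subset_support hvj hbp))
  choose R hR hQR hRlen hRsupp using fun i =>
    SimpleGraph.exists_isPath_extending (hconn i) (hb i) (ha i) (hQpath i) (hQA i)
  have hRL : ∀ i, L ≤ (R i).length := fun i => (hQlen i).trans (by exact_mod_cast hRlen i)
  have hRR : ∀ i j, i ≠ j → ∀ v, v ∈ (R i).support → v ∈ (R j).support → v = r := by
    intro i j hij v hvi hvj
    rcases hRsupp i v hvi with h₁ | h₁ <;> rcases hRsupp j v hvj with h₂ | h₂
    · exact hQQ i j hij v h₁ h₂
    · exact absurd h₁ (hAQ j i hij.symm v h₂)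
    · exact absurd h₂ (hAQ i j hij v h₁)
    · exact absurd h₂ (Set.disjoint_left.1 (hdisj i j hij) h₁)
  have hdist : ∀ i j, i ≠ j → 2 * L ≤ spDist T len (g (a i)) (g (a j)) := by
    intro i j hij
    have hpath : ((R i).reverse.append (R j)).IsPath :=
      (hR i).reverse.append (hR j) fun z hz hz' => hRR i j hij z (by simpa using hz) hz'
    have := hg (a i) (a j)
    rw [hS.dist_eq_length hpath, SimpleGraph.Walk.length_append,
      SimpleGraph.Walk.length_reverse, Nat.cast_add] at this
    linarith [hRL i, hRL j]
  have tri := hT.spDist_triangle hlen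
  have symm := hT.spDist_comm hlen
  refine le_trans (Finset.card_sq_mul_le_sum I hL (c := spDist T len x (g r))
    (f := fun i => spDist T len x (q i)) (x := fun i => spDist T len (g r) (g (a i))) ?_ ?_ ?_)
    (SimpleGraph.sum_le_edgeSum_of_isPath (F := fun u v => spDist T len (g u) (g v))
      (fun _ _ => SimpleGraph.spDist_nonneg hlen _ _) (fun _ => SimpleGraph.spDist_self hlen _)
      (fun _ _ => symm _ _) (fun _ _ _ => tri _ _ _) I R (fun i _ => hR i) ?_)
  · intro i hi j hj hij
    refine le_trans ?_ (hT.spDist_le_abs_sub hlen hP (hqP i hi) (hqP j hj))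
    linarith [hdist i j hij, hq i hi, hq j hj, tri (g (a i)) (q i) (g (a j)),
      tri (q i) (q j) (g (a j)), symm (q j) (g (a j))]
  · intro i _
    have := hg r (a i)
    rw [hS.dist_eq_length (hR i)] at this
    exact (hRL i).trans this
  · intro i hi
    have h : |spDist T len x (q i) - spDist T len x (g r)| ≤ spDist T len (g r) (q i) := by
      rw [abs_le]
      constructor <;>
        linarith [tri x (g r) (q i), tri x (q i) (g r), symm (q i) (g r)]
    linarith [hq i hi, tri (g r) (g (a i)) (q i)]
  · intro i _ j _ hij e hei hej
    induction e with
    | _ u v =>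
      refine ((R i).adj_of_mem_edges hei).ne ?_
      rw [hRR i j hij u ((R i).fst_mem_support_of_mem_edges hei)
          ((R j).fst_mem_support_of_mem_edges hej),
        hRR i j hij v ((R i).snd_mem_support_of_mem_edges hei)
          ((R j).snd_mem_support_of_mem_edges hej)]
end
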